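/- Let α, β > −1 and let N ≥ 2 be even. Then for every f ∈ C_c^∞(0,π) and every θ ∈ (0,π), the integral ∫₀^π R_N(θ,φ) f(φ) dμ(φ) converges absolutely and R_N f(θ) = (−1)^{N/2} f(θ) + ∫₀^π R_N(θ,φ) f(φ) dμ(φ). -/

import Mathlib

open MeasureTheory Real Set Filter
open scoped Classical

noncomputable section

/-- The Jacobi measure dμ_{α,β} on (0,π). -/
def jacobiMeasure (α β : ℝ) : Measure ℝ :=
  (volume.restrict (Set.Ioo 0 π)).withDensity
    (fun θ => ENNReal.ofReal ((Real.sin (θ/2)) ^ (2*α+1) * (Real.cos (θ/2)) ^ (2*β+1)))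

/-- The classical Jacobi polynomial `P_n^{(α,β)}`. -/
def jacobiPoly (α β : ℝ) (n : ℕ) (x : ℝ) : ℝ :=
  ∑ k ∈ Finset.range (n+1),
    (Real.Gamma ((n:ℝ)+α+1) / (Real.Gamma (α+(k:ℝ)+1) * (Nat.factorial (n-k)))) *
    (Real.Gamma ((n:ℝ)+β+1) / (Real.Gamma ((n:ℝ)+β-(k:ℝ)+1) * (Nat.factorial k))) *
    ((x-1)/2)^k * ((x+1)/2)^(n-k)

/-- Normalized trigonometric Jacobi polynomial `𝒫_n(θ) = c_n P_n^{(α,β)}(cos θ)`. -/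
def nJacobi (α β : ℝ) (c : ℕ → ℝ) (n : ℕ) (θ : ℝ) : ℝ :=
  c n * jacobiPoly α β n (Real.cos θ)

def jacobiTau (α β : ℝ) : ℝ := (α + β + 1) / 2

/-- `c` is an admissible sequence of (positive) normalizing constants. -/
def JacobiNormalized (α β : ℝ) (c : ℕ → ℝ) : Prop :=
  (∀ n, 0 < c n) ∧
  ∀ n, ∫ θ, (nJacobi α β c n θ)^2 ∂(jacobiMeasure α β) = 1

/-- The Jacobi-Poisson kernel. -/
def poissonKer (α β : ℝ) (c : ℕ → ℝ) (t θ φ : ℝ) : ℝ :=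
  ∑' n : ℕ, Real.exp (-t * |(n:ℝ) + jacobiTau α β|) * nJacobi α β c n θ * nJacobi α β c n φ

/-- The Riesz-Jacobi kernel of order `N`. -/
def rieszKer (α β : ℝ) (c : ℕ → ℝ) (N : ℕ) (θ φ : ℝ) : ℝ :=
  (1 / Real.Gamma (N:ℝ)) *
    ∫ t in Set.Ioi (0:ℝ), iteratedDeriv N (fun θ' => poissonKer α β c t θ' φ) θ * t ^ (N-1)

/-- Inner product in `L²(dμ_{α,β})`. -/
def jacobiInner (α β : ℝ) (f g : ℝ → ℝ) : ℝ := ∫ θ, f θ * g θ ∂(jacobiMeasure α β)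

/-- The Riesz-Jacobi transform of order `N` on test functions. -/
def rieszTransform (α β : ℝ) (c : ℕ → ℝ) (N : ℕ) (f : ℝ → ℝ) (θ : ℝ) : ℝ :=
  ∑' n : ℕ, |((n:ℝ)+1) + jacobiTau α β| ^ (-(N:ℝ)) *
    jacobiInner α β f (nJacobi α β c (n+1)) *
    iteratedDeriv N (nJacobi α β c (n+1)) θ

/-- `f ∈ C_c^∞(0,π)`. -/
def IsCcSmooth (f : ℝ → ℝ) : Prop :=
  ContDiff ℝ (⊤ : ℕ∞) f ∧ HasCompactSupport f ∧ tsupport f ⊆ Set.Ioo 0 π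

section Part1

open Polynomial in
/-- coefficients -/
def jA (α β : ℝ) (n k : ℕ) : ℝ :=
  (Real.Gamma ((n:ℝ)+α+1) / (Real.Gamma (α+(k:ℝ)+1) * (Nat.factorial (n-k)))) *
    (Real.Gamma ((n:ℝ)+β+1) / (Real.Gamma ((n:ℝ)+β-(k:ℝ)+1) * (Nat.factorial k)))

open Polynomial in
/-- The Jacobi polynomial as a polynomial. -/
def jP (α β : ℝ) (n : ℕ) : Polynomial ℝ :=
  ∑ k ∈ Finset.range (n+1), C (jA α β n k) * (C (1/2) * (X - 1))^k * (C (1/2) * (X + 1))^(n-k)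

lemma jP_eval (α β : ℝ) (n : ℕ) (x : ℝ) : (jP α β n).eval x = jacobiPoly α β n x := by
  unfold jP jacobiPoly jA
  rw [Polynomial.eval_finsetSum]
  refine Finset.sum_congr rfl fun k _ => ?_
  simp only [Polynomial.eval_mul, Polynomial.eval_pow, Polynomial.eval_C, Polynomial.eval_sub,
    Polynomial.eval_add, Polynomial.eval_X, Polynomial.eval_one]
  congr 2 <;> ring

lemma jA_pos {α β : ℝ} (hα : -1 < α) (hβ : -1 < β) {n k : ℕ} (hk : k ≤ n) : 0 < jA α β n k := by
  have hk' : (k:ℝ) ≤ n := by exact_mod_cast hk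
  have h0 : (0:ℝ) ≤ k := Nat.cast_nonneg k
  have h1 : 0 < Real.Gamma ((n:ℝ)+α+1) := Real.Gamma_pos_of_pos (by linarith)
  have h2 : 0 < Real.Gamma ((n:ℝ)+β+1) := Real.Gamma_pos_of_pos (by linarith)
  have h3 : 0 < Real.Gamma (α+(k:ℝ)+1) := Real.Gamma_pos_of_pos (by linarith)
  have h4 : 0 < Real.Gamma ((n:ℝ)+β-(k:ℝ)+1) := Real.Gamma_pos_of_pos (by linarith)
  unfold jA
  positivity

lemma jA_rec {α β : ℝ} (hα : -1 < α) (hβ : -1 < β) {n k : ℕ} (hk : k + 1 ≤ n) :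
    jA α β n (k+1) * ((k+1) * (k+1+α)) = jA α β n k * ((n-k) * (n-k+β)) := by
  obtain ⟨j, rfl⟩ := Nat.exists_eq_add_of_le hk
  have h0 : (0:ℝ) ≤ k := Nat.cast_nonneg k
  have hj : (0:ℝ) ≤ j := Nat.cast_nonneg j
  unfold jA
  have e1 : k + 1 + j - (k+1) = j := by omega
  have e2 : k + 1 + j - k = j + 1 := by omega
  rw [e1, e2]
  push_cast
  have g1 : Real.Gamma (α + ((k:ℝ)+1) + 1) = (α + k + 1) * Real.Gamma (α + k + 1) := by
    rw [← Real.Gamma_add_one (by linarith)]; ring_nf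
  have g2 : Real.Gamma ((k:ℝ)+1+j+β-k+1) = (j + β + 1) * Real.Gamma (j+β+1) := by
    rw [← Real.Gamma_add_one (by linarith)]; ring_nf
  have g3 : Real.Gamma ((k:ℝ)+1+j+β-(k+1)+1) = Real.Gamma (j+β+1) := by ring_nf
  rw [g1, g2, g3, Nat.factorial_succ, Nat.factorial_succ]
  have h3 : 0 < Real.Gamma (α+(k:ℝ)+1) := Real.Gamma_pos_of_pos (by linarith)
  have h4 : 0 < Real.Gamma ((j:ℝ)+β+1) := Real.Gamma_pos_of_pos (by linarith)
  have h5 : 0 < α + k + 1 := by linarith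
  have h6 : 0 < j + β + 1 := by linarith
  push_cast
  field_simp
  ring

open Polynomial in
lemma jP_natDegree {α β : ℝ} (hα : -1 < α) (hβ : -1 < β) (n : ℕ) : (jP α β n).natDegree = n := by
  have key : ∀ k ∈ Finset.range (n+1),
      C (jA α β n k) * (C (1/2) * (X - 1))^k * (C (1/2) * (X + 1))^(n-k)
       = C (jA α β n k * (1/2)^n) * ((X - 1)^k * (X+1)^(n-k)) := by
    intro k hk
    have hk : k ≤ n := by simpa [Nat.lt_succ_iff] using hk
    have : (C (1/2) : ℝ[X])^n = C (1/2)^k * C (1/2)^(n-k) := by rw [← pow_add]; congr 1; omega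
    rw [C_mul, C_pow, this, mul_pow, mul_pow]; ring
  have mon : ∀ k ≤ n, ((X - 1 : ℝ[X])^k * (X+1)^(n-k)).Monic ∧
      ((X - 1 : ℝ[X])^k * (X+1)^(n-k)).natDegree = n := by
    intro k hk
    have m1 : (X - 1 : ℝ[X]).Monic := by simpa using monic_X_sub_C (1:ℝ)
    have m2 : (X + 1 : ℝ[X]).Monic := by simpa using monic_X_add_C (1:ℝ)
    refine ⟨(m1.pow k).mul (m2.pow _), ?_⟩
    have d1 : (X - 1 : ℝ[X]).natDegree = 1 := by simpa using natDegree_X_sub_C (1:ℝ)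
    have d2 : (X + 1 : ℝ[X]).natDegree = 1 := by simpa using natDegree_X_add_C (1:ℝ)
    rw [(m1.pow k).natDegree_mul (m2.pow _), m1.natDegree_pow, m2.natDegree_pow, d1, d2]; omega
  have hle : (jP α β n).natDegree ≤ n := by
    unfold jP
    refine natDegree_sum_le_of_forall_le _ _ fun k hk => ?_
    rw [key k hk]
    refine (natDegree_C_mul_le _ _).trans (mon k ?_).2.le
    simpa [Nat.lt_succ_iff] using hk
  refine natDegree_eq_of_le_of_coeff_ne_zero hle ?_
  unfold jP
  rw [Finset.sum_congr rfl key, finsetSum_coeff]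
  refine ne_of_gt (Finset.sum_pos (fun k hk => ?_) ⟨0, by simp⟩)
  have hk : k ≤ n := by simpa [Nat.lt_succ_iff] using hk
  rw [coeff_C_mul]
  have := (mon k hk).1.coeff_natDegree
  rw [(mon k hk).2] at this
  rw [this]
  have := jA_pos hα hβ hk
  positivity

open Polynomial in
lemma basis_term (α β : ℝ) (k j : ℕ) :
    let u : ℝ[X] := C (1/2) * (X - 1)
    let v : ℝ[X] := C (1/2) * (X + 1)
    let e : ℝ[X] := u^k * v^j
    (1 - X^2) * derivative (derivative e) + (C (β-α) - C (α+β+2) * X) * derivative e =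
      - (C ((k:ℝ)*(k+α)) * (u^(k-1) * v^(j+1)) + C (2*(k:ℝ)*j+(α+1)*j+(β+1)*k) * (u^k * v^j) +
        C ((j:ℝ)*(j+β)) * (u^(k+1) * v^(j-1))) := by
  intro u v e
  have hu : derivative u = C (1/2) := by simp [u]
  have hv : derivative v = C (1/2) := by simp [v]
  have hvu : (1:ℝ[X]) = v - u := by
    simp only [u, v]; rw [← mul_sub]
    have : (X + 1 - (X - 1) : ℝ[X]) = C 2 := by rw [C_ofNat]; ring
    rw [this, ← C_mul]; norm_num
  have hX : (X:ℝ[X]) = u + v := by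
    simp only [u, v]; rw [← mul_add]
    have : (X - 1 + (X + 1) : ℝ[X]) = C 2 * X := by rw [C_ofNat]; ring
    rw [this, ← mul_assoc, ← C_mul]; norm_num
  have h1 : (1 - X^2 : ℝ[X]) = - 4 * (u * v) := by
    have : (1 - X^2 : ℝ[X]) = 1^2 - X^2 := by ring
    rw [this, hX, hvu]; ring
  have h2 : (C (β-α) - C (α+β+2) * X : ℝ[X]) = - 2 * (C (α+1) * v + C (β+1) * u) := by
    have : (C (β-α) - C (α+β+2) * X : ℝ[X]) = C (β-α) * 1 - C (α+β+2) * X := by ring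
    rw [this, hX, hvu]; simp only [C_sub, C_add, C_ofNat, C_1]; ring
  have hh : (2:ℝ[X]) * C (1/2) = 1 := by
    have h22 : (2:ℝ[X]) = C 2 := by rw [C_ofNat]
    rw [h22, ← C_mul]; norm_num
  have D1 : ∀ k j : ℕ, 2 * derivative (u^k * v^j) =
      (k:ℝ[X]) * (u^(k-1) * v^j) + (j:ℝ[X]) * (u^k * v^(j-1)) := by
    intro k j
    rw [derivative_mul, derivative_pow, derivative_pow, hu, hv, C_eq_natCast, C_eq_natCast]
    linear_combination ((k:ℝ[X]) * (u^(k-1) * v^j) + (j:ℝ[X]) * (u^k * v^(j-1))) * hh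
  have D2 : 4 * derivative (derivative e) = (k:ℝ[X]) * ((k-1 : ℕ) * (u^(k-1-1) * v^j) +
      (j:ℝ[X]) * (u^(k-1) * v^(j-1))) + (j:ℝ[X]) * ((k:ℝ[X]) * (u^(k-1) * v^(j-1)) +
      ((j-1 : ℕ):ℝ[X]) * (u^k * v^(j-1-1))) := by
    have : 4 * derivative (derivative e) = 2 * derivative (2 * derivative e) := by
      rw [derivative_mul (f := (2:ℝ[X])), derivative_ofNat]; ring
    rw [this, D1 k j, derivative_add, derivative_mul, derivative_mul (f := (j:ℝ[X])),
      derivative_natCast, derivative_natCast]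
    linear_combination (k:ℝ[X]) * D1 (k-1) j + (j:ℝ[X]) * D1 k (j-1)
  rw [h1, h2]
  have D3 := D1 k j
  have goal' : -4 * (u * v) * derivative (derivative e) +
      -2 * (C (α+1) * v + C (β+1) * u) * derivative e =
      -((u*v) * (4 * derivative (derivative e)) +
        (C (α+1) * v + C (β+1) * u) * (2 * derivative e)) := by ring
  rw [goal', D2, D3]
  clear_value u v
  clear goal' D2 D3 D1 e h1 h2 hX hvu hu hv
  congr 1
  simp only [C_add, C_mul, C_1, C_ofNat, C_eq_natCast]
  rcases k with _ | _ | k <;> rcases j with _ | _ | j <;>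
  simp only [Nat.add_sub_cancel, Nat.zero_sub, Nat.cast_zero, zero_add, Nat.cast_add, Nat.cast_one,
    Nat.sub_self] <;> ring

open Polynomial in
lemma jP_ode {α β : ℝ} (hα : -1 < α) (hβ : -1 < β) (n : ℕ) :
    (1 - X^2) * derivative (derivative (jP α β n)) +
      (C (β-α) - C (α+β+2) * X) * derivative (jP α β n) = - C ((n:ℝ)*(n+α+β+1)) * jP α β n := by
  set u : ℝ[X] := C (1/2) * (X - 1) with hu
  set v : ℝ[X] := C (1/2) * (X + 1) with hv
  have hj : jP α β n = ∑ k ∈ Finset.range (n+1), C (jA α β n k) * (u^k * v^(n-k)) := by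
    unfold jP; simp only [mul_assoc, ← hu, ← hv]
  rw [hj]
  simp only [derivative_sum, derivative_C_mul, Finset.mul_sum, ← Finset.sum_add_distrib]
  have h : ∀ k ∈ Finset.range (n+1),
      (1 - X^2) * (C (jA α β n k) * derivative (derivative (u^k * v^(n-k)))) +
      (C (β-α) - C (α+β+2) * X) * (C (jA α β n k) * derivative (u^k * v^(n-k))) =
      - (C (jA α β n k * ((k:ℝ)*(k+α))) * (u^(k-1) * v^(n-k+1)) +
        C (jA α β n k * (2*(k:ℝ)*(n-k:ℕ)+(α+1)*(n-k:ℕ)+(β+1)*k)) * (u^k * v^(n-k)) +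
        C (jA α β n k * (((n-k:ℕ):ℝ)*((n-k:ℕ)+β))) * (u^(k+1) * v^(n-k-1))) := by
    intro k hk
    have := basis_term α β k (n-k)
    simp only [← hu, ← hv] at this
    simp only [C_mul (a := jA α β n k)]
    linear_combination C (jA α β n k) * this
  rw [Finset.sum_congr rfl h, Finset.sum_neg_distrib, Finset.sum_add_distrib, Finset.sum_add_distrib]
  -- shift the first and the last sum
  have s1 : ∑ k ∈ Finset.range (n+1), C (jA α β n k * ((k:ℝ)*(k+α))) * (u^(k-1) * v^(n-k+1)) =
      ∑ k ∈ Finset.range (n+1), C (jA α β n k * (((n:ℝ)-k)*(n-k+β))) * (u^k * v^(n-k)) := by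
    rw [Finset.sum_range_succ', Finset.sum_range_succ]
    simp only [Nat.cast_zero, zero_mul, mul_zero, C_0, add_zero, sub_self]
    refine Finset.sum_congr rfl fun k hk => ?_
    have hk : k + 1 ≤ n := by simpa using hk
    have := jA_rec hα hβ hk
    push_cast
    rw [this]
    congr 3; omega
  have s2 : ∑ k ∈ Finset.range (n+1),
      C (jA α β n k * (((n-k:ℕ):ℝ)*((n-k:ℕ)+β))) * (u^(k+1) * v^(n-k-1)) =
      ∑ k ∈ Finset.range (n+1), C (jA α β n k * ((k:ℝ)*(k+α))) * (u^k * v^(n-k)) := by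
    rw [Finset.sum_range_succ, Finset.sum_range_succ']
    simp only [Nat.cast_zero, zero_mul, mul_zero, C_0, add_zero, Nat.sub_self]
    refine Finset.sum_congr rfl fun k hk => ?_
    have hk : k + 1 ≤ n := by simpa using hk
    have := jA_rec hα hβ hk
    push_cast
    rw [this, Nat.cast_sub (by omega)]
    congr 3
  rw [s1, s2, ← Finset.sum_add_distrib, ← Finset.sum_add_distrib, ← Finset.sum_neg_distrib]
  refine Finset.sum_congr rfl fun k hk => ?_
  have hk : k ≤ n := by simpa [Nat.lt_succ_iff] using hk
  rw [← add_mul, ← add_mul, ← C_add, ← C_add, ← neg_mul, ← C_neg, ← C_neg,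
    ← mul_assoc (C (-((n:ℝ) * (n + α + β + 1)))), ← C_mul, Nat.cast_sub hk]
  congr 2
  ring

end Part1

section Part2

/-- The weight. -/
def jw (α β θ : ℝ) : ℝ := (Real.sin (θ/2)) ^ (2*α+1) * (Real.cos (θ/2)) ^ (2*β+1)

lemma sinh_pos {θ : ℝ} (h : θ ∈ Ioo 0 π) : 0 < Real.sin (θ/2) :=
  Real.sin_pos_of_pos_of_lt_pi (by linarith [h.1]) (by linarith [h.1, h.2])

lemma cosh_pos {θ : ℝ} (h : θ ∈ Ioo 0 π) : 0 < Real.cos (θ/2) :=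
  Real.cos_pos_of_mem_Ioo ⟨by linarith [h.1, h.2], by linarith [h.1, h.2]⟩

lemma jw_pos {α β θ : ℝ} (h : θ ∈ Ioo 0 π) : 0 < jw α β θ :=
  mul_pos (Real.rpow_pos_of_pos (sinh_pos h) _) (Real.rpow_pos_of_pos (cosh_pos h) _)

lemma jw_meas (α β : ℝ) : Measurable (jw α β) := by
  unfold jw; fun_prop

lemma hasDerivAt_sinpow {a θ : ℝ} (h : θ ∈ Ioo 0 π) :
    HasDerivAt (fun θ => Real.sin (θ/2) ^ (2*a+2))
      ((a+1) * (Real.sin (θ/2) ^ (2*a+1) * Real.cos (θ/2))) θ := by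
  have h1 : HasDerivAt (fun θ : ℝ => Real.sin (θ/2)) (Real.cos (θ/2) * (1/2)) θ :=
    ((hasDerivAt_id θ).div_const 2).sin
  have := h1.rpow_const (p := 2*a+2) (Or.inl (sinh_pos h).ne')
  convert this using 1
  rw [show 2*a+2-1 = 2*a+1 by ring]; ring

lemma hasDerivAt_cospow {a θ : ℝ} (h : θ ∈ Ioo 0 π) :
    HasDerivAt (fun θ => Real.cos (θ/2) ^ (2*a+2))
      (-(a+1) * (Real.cos (θ/2) ^ (2*a+1) * Real.sin (θ/2))) θ := by
  have h1 : HasDerivAt (fun θ : ℝ => Real.cos (θ/2)) (-Real.sin (θ/2) * (1/2)) θ :=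
    ((hasDerivAt_id θ).div_const 2).cos
  have := h1.rpow_const (p := 2*a+2) (Or.inl (cosh_pos h).ne')
  convert this using 1
  rw [show 2*a+2-1 = 2*a+1 by ring]; ring

lemma cont_sinpow {a : ℝ} (ha : -1 < a) : Continuous (fun θ : ℝ => Real.sin (θ/2) ^ (2*a+2)) :=
  (Real.continuous_rpow_const (by linarith)).comp (by fun_prop)

lemma cont_cospow {a : ℝ} (ha : -1 < a) : Continuous (fun θ : ℝ => Real.cos (θ/2) ^ (2*a+2)) :=
  (Real.continuous_rpow_const (by linarith)).comp (by fun_prop)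

lemma jw_integrable {α β : ℝ} (hα : -1 < α) (hβ : -1 < β) : IntegrableOn (jw α β) (Ioo 0 π) := by
  have hpi := Real.pi_pos
  have A : IntegrableOn (fun θ => (α+1) * (Real.sin (θ/2) ^ (2*α+1) * Real.cos (θ/2))) (Ioc 0 π) := by
    refine intervalIntegral.integrableOn_deriv_of_nonneg (cont_sinpow hα).continuousOn
      (fun x hx => hasDerivAt_sinpow hx) fun x hx => ?_
    have := (sinh_pos hx).le
    have := (cosh_pos hx).le
    have : 0 ≤ α + 1 := by linarith
    positivity
  have B : IntegrableOn (fun θ => (β+1) * (Real.cos (θ/2) ^ (2*β+1) * Real.sin (θ/2))) (Ioc 0 π) := by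
    refine intervalIntegral.integrableOn_deriv_of_nonneg (g := fun θ => - Real.cos (θ/2) ^ (2*β+2))
      (cont_cospow hβ).neg.continuousOn
      (fun x hx => ?_) fun x hx => ?_
    · exact (hasDerivAt_cospow hx).neg.congr_deriv (by ring)
    have := (sinh_pos hx).le
    have := (cosh_pos hx).le
    have : 0 ≤ β + 1 := by linarith
    positivity
  have h1 : IntegrableOn (jw α β) (Ioc 0 (π/2)) := by
    have A' : IntegrableOn (fun θ => (α+1) * (Real.sin (θ/2) ^ (2*α+1) * Real.cos (θ/2))) (Icc 0 (π/2)) := by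
      rw [integrableOn_Icc_iff_integrableOn_Ioc]
      exact A.mono_set (Ioc_subset_Ioc_right (by linarith))
    have := A'.mul_continuousOn (g' := fun θ => Real.cos (θ/2) ^ (2*β) * (α+1)⁻¹) ?_ isCompact_Icc
    · refine (this.mono_set Ioc_subset_Icc_self).congr_fun (fun θ hθ => ?_) measurableSet_Ioc
      have hc := cosh_pos (θ := θ) ⟨hθ.1, by linarith [hθ.2]⟩
      have : α + 1 ≠ 0 := by linarith
      simp only [jw]
      rw [Real.rpow_add hc, Real.rpow_one]; field_simp
    · refine ContinuousOn.mul (ContinuousOn.rpow_const (by fun_prop) fun x hx => Or.inl ?_) continuousOn_const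
      exact (Real.cos_pos_of_mem_Ioo ⟨by linarith [hx.1, hx.2], by linarith [hx.1, hx.2]⟩).ne'
  have h2 : IntegrableOn (jw α β) (Ico (π/2) π) := by
    have B' : IntegrableOn (fun θ => (β+1) * (Real.cos (θ/2) ^ (2*β+1) * Real.sin (θ/2))) (Icc (π/2) π) := by
      exact B.mono_set (fun x hx => ⟨by linarith [hx.1], hx.2⟩)
    have := B'.mul_continuousOn (g' := fun θ => Real.sin (θ/2) ^ (2*α) * (β+1)⁻¹) ?_ isCompact_Icc
    · refine (this.mono_set Ico_subset_Icc_self).congr_fun (fun θ hθ => ?_) measurableSet_Ico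
      have hc := sinh_pos (θ := θ) ⟨by linarith [hθ.1], hθ.2⟩
      have : β + 1 ≠ 0 := by linarith
      simp only [jw]
      rw [Real.rpow_add hc, Real.rpow_one]; field_simp
    · refine ContinuousOn.mul (ContinuousOn.rpow_const (by fun_prop) fun x hx => Or.inl ?_) continuousOn_const
      exact (Real.sin_pos_of_pos_of_lt_pi (by linarith [hx.1]) (by linarith [hx.1, hx.2])).ne'
  refine (h1.union h2).mono_set fun x hx => ?_
  rcases le_total x (π/2) with h | h
  · exact Or.inl ⟨hx.1, h⟩
  · exact Or.inr ⟨h, hx.2⟩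

lemma jm_def (α β : ℝ) : jacobiMeasure α β =
    (volume.restrict (Ioo 0 π)).withDensity (fun θ => ENNReal.ofReal (jw α β θ)) := rfl

lemma jm_finite {α β : ℝ} (hα : -1 < α) (hβ : -1 < β) : IsFiniteMeasure (jacobiMeasure α β) := by
  rw [jm_def]
  exact isFiniteMeasure_withDensity_ofReal (jw_integrable hα hβ).2

lemma jm_ae (α β : ℝ) : ∀ᵐ θ ∂(jacobiMeasure α β), θ ∈ Ioo 0 π :=
  (withDensity_absolutelyContinuous _ _).ae_le (ae_restrict_mem measurableSet_Ioo)

lemma jm_ac (α β : ℝ) : jacobiMeasure α β ≪ volume :=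
  (withDensity_absolutelyContinuous _ _).trans Measure.restrict_le_self.absolutelyContinuous

lemma jm_ae_of_ae {α β : ℝ} {p : ℝ → Prop} (h : ∀ᵐ θ ∂(jacobiMeasure α β), p θ) :
    ∀ᵐ θ ∂(volume.restrict (Ioo 0 π)), p θ := by
  rw [jm_def, ae_withDensity_iff (jw_meas α β).ennreal_ofReal] at h
  filter_upwards [h, ae_restrict_mem measurableSet_Ioo] with θ h1 h2
  exact h1 (by simpa using jw_pos h2)

lemma jm_integral (α β : ℝ) (g : ℝ → ℝ) :
    ∫ θ, g θ ∂(jacobiMeasure α β) = ∫ θ in Ioo 0 π, jw α β θ * g θ := by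
  rw [jm_def, integral_withDensity_eq_integral_toReal_smul (jw_meas α β).ennreal_ofReal
    (by simp)]
  refine setIntegral_congr_fun measurableSet_Ioo fun θ hθ => ?_
  simp only [smul_eq_mul]
  rw [ENNReal.toReal_ofReal (jw_pos hθ).le]

lemma jm_integrable_iff (α β : ℝ) (g : ℝ → ℝ) :
    Integrable g (jacobiMeasure α β) ↔ IntegrableOn (fun θ => jw α β θ * g θ) (Ioo 0 π) := by
  rw [jm_def, integrable_withDensity_iff_integrable_smul' (jw_meas α β).ennreal_ofReal
    (by simp)]
  refine integrable_congr ?_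
  filter_upwards [ae_restrict_mem measurableSet_Ioo] with θ hθ
  simp only [smul_eq_mul]
  rw [ENNReal.toReal_ofReal (jw_pos hθ).le]

lemma jm_memLp {α β : ℝ} (hα : -1 < α) (hβ : -1 < β) {g : ℝ → ℝ} {C : ℝ}
    (hm : AEStronglyMeasurable g (jacobiMeasure α β)) (hg : ∀ θ ∈ Ioo 0 π, |g θ| ≤ C) (p : ENNReal) :
    MemLp g p (jacobiMeasure α β) := by
  have := jm_finite hα hβ
  refine MemLp.of_bound hm C ?_
  filter_upwards [jm_ae α β] with θ hθ using hg θ hθ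

lemma jm_memLp_cont {α β : ℝ} (hα : -1 < α) (hβ : -1 < β) {g : ℝ → ℝ} 
    (hm : Continuous g) (p : ENNReal) : MemLp g p (jacobiMeasure α β) := by
  obtain ⟨C, hC⟩ := isCompact_Icc.exists_bound_of_continuousOn (hm.continuousOn (s := Icc 0 π))
  exact jm_memLp hα hβ hm.aestronglyMeasurable (fun θ h => hC θ (Ioo_subset_Icc_self h)) p

lemma jm_integrable_cont {α β : ℝ} (hα : -1 < α) (hβ : -1 < β) {g : ℝ → ℝ} 
    (hm : Continuous g) : Integrable g (jacobiMeasure α β) :=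
  memLp_one_iff_integrable.1 (jm_memLp_cont hα hβ hm 1)

/-- FTC on `(0,π)`. -/
lemma jm_ftc {α β : ℝ} {F G : ℝ → ℝ} (hF : ContinuousOn F (Icc 0 π)) (h0 : F 0 = 0) (h1 : F π = 0)
    (hd : ∀ θ ∈ Ioo 0 π, HasDerivAt F (jw α β θ * G θ) θ)
    (hi : Integrable G (jacobiMeasure α β)) : ∫ θ, G θ ∂(jacobiMeasure α β) = 0 := by
  rw [jm_integral]
  rw [jm_integrable_iff] at hi
  rw [← integral_Ioc_eq_integral_Ioo, ← intervalIntegral.integral_of_le Real.pi_pos.le]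
  rw [intervalIntegral.integral_eq_sub_of_hasDerivAt_of_le Real.pi_pos.le hF hd, h0, h1, sub_self]
  rw [intervalIntegrable_iff_integrableOn_Ioo_of_le Real.pi_pos.le]
  exact hi

open Polynomial in
/-- The Jacobi operator on polynomials. -/
def jL (α β : ℝ) (p : ℝ[X]) : ℝ[X] :=
  (1 - X^2) * derivative (derivative p) + (C (β-α) - C (α+β+2) * X) * derivative p

open Polynomial in
lemma jm_ibp {α β : ℝ} (hα : -1 < α) (hβ : -1 < β) (p q : ℝ[X]) :
    ∫ θ, (jL α β p * q).eval (Real.cos θ) ∂(jacobiMeasure α β) =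
      - ∫ θ, ((1 - X^2) * derivative p * derivative q).eval (Real.cos θ) ∂(jacobiMeasure α β) := by
  have hc : ∀ p : ℝ[X], Continuous fun θ => p.eval (Real.cos θ) :=
    fun p => p.continuous.comp Real.continuous_cos
  rw [eq_neg_iff_add_eq_zero, ← integral_add (jm_integrable_cont hα hβ (hc _))
    (jm_integrable_cont hα hβ (hc _))]
  refine jm_ftc (F := fun θ => (-2) * ((Real.sin (θ/2) ^ (2*α+2) * Real.cos (θ/2) ^ (2*β+2)) *
    (derivative p * q).eval (Real.cos θ))) ?_ ?_ ?_ ?_ ?_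
  · exact (continuous_const.mul (((cont_sinpow hα).mul (cont_cospow hβ)).mul (hc _))).continuousOn
  · simp [Real.zero_rpow (show 2*α+2 ≠ 0 by linarith)]
  · simp [Real.zero_rpow (show 2*β+2 ≠ 0 by linarith)]
  · intro θ hθ
    have d1 := ((hasDerivAt_sinpow (a := α) hθ).mul (hasDerivAt_cospow (a := β) hθ))
    have d2 : HasDerivAt (fun θ => (derivative p * q).eval (Real.cos θ))
      ((derivative (derivative p * q)).eval (Real.cos θ) * (-Real.sin θ)) θ :=
      HasDerivAt.comp (h₂ := fun x => (derivative p * q).eval x) θ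
        ((derivative p * q).hasDerivAt _) (Real.hasDerivAt_cos θ)
    refine ((d1.mul d2).const_mul (-2)).congr_deriv ?_
    have hs := sinh_pos hθ
    have hc := cosh_pos hθ
    have e1 : Real.sin (θ/2) ^ (2*α+2) = Real.sin (θ/2) ^ (2*α+1) * Real.sin (θ/2) := by
      rw [← Real.rpow_add_one hs.ne']; ring_nf
    have e2 : Real.cos (θ/2) ^ (2*β+2) = Real.cos (θ/2) ^ (2*β+1) * Real.cos (θ/2) := by
      rw [← Real.rpow_add_one hc.ne']; ring_nf
    have e3 : Real.sin θ = 2 * Real.sin (θ/2) * Real.cos (θ/2) := by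
      rw [← Real.sin_two_mul]; ring_nf
    have e4 : Real.cos θ = 2 * Real.cos (θ/2)^2 - 1 := by
      rw [← Real.cos_two_mul]; ring_nf
    have e5 : Real.sin (θ/2)^2 = 1 - Real.cos (θ/2)^2 := Real.sin_sq _
    simp only [Pi.mul_apply, e1, e2, e3, jw, jL, derivative_mul, eval_add, eval_mul, eval_sub, eval_pow, eval_one,
      eval_X, eval_C]
    generalize eval (Real.cos θ) (derivative (derivative p)) = p2
    generalize eval (Real.cos θ) (derivative p) = p1
    generalize eval (Real.cos θ) (derivative q) = q1
    generalize eval (Real.cos θ) q = q0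
    rw [e4]
    generalize Real.cos (θ/2) ^ (2*β+1) = C1
    generalize Real.sin (θ/2) ^ (2*α+1) = S1
    generalize Real.cos (θ/2) = c at *
    generalize Real.sin (θ/2) = s at *
    linear_combination S1 * C1 * (4 * c^2 * (p2*q0+p1*q1) + 2 * (β+1) * p1 * q0) * e5
  · exact ((jm_integrable_cont hα hβ (hc _)).add (jm_integrable_cont hα hβ (hc _)))

end Part2

section Part3

open Polynomial in
/-- normalized polynomial -/
def jq (α β : ℝ) (c : ℕ → ℝ) (n : ℕ) : ℝ[X] := C (c n) * jP α β n

/-- eigenvalue -/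
def jnu (α β : ℝ) (n : ℕ) : ℝ := n * (n + α + β + 1)

lemma nJ_eq (α β : ℝ) (c : ℕ → ℝ) (n : ℕ) (θ : ℝ) :
    nJacobi α β c n θ = (jq α β c n).eval (Real.cos θ) := by
  simp [nJacobi, jq, jP_eval]

lemma nJ_cont (α β : ℝ) (c : ℕ → ℝ) (n : ℕ) : Continuous (nJacobi α β c n) := by
  have : nJacobi α β c n = fun θ => (jq α β c n).eval (Real.cos θ) := funext (nJ_eq α β c n)
  rw [this]
  exact (Polynomial.continuous _).comp Real.continuous_cos

open Polynomial in
lemma jq_ode {α β : ℝ} (hα : -1 < α) (hβ : -1 < β) (c : ℕ → ℝ) (n : ℕ) :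
    jL α β (jq α β c n) = - C (jnu α β n) * jq α β c n := by
  have := jP_ode hα hβ n
  simp only [jL, jq, derivative_C_mul, jnu]
  linear_combination C (c n) * this

lemma jq_natDegree {α β : ℝ} (hα : -1 < α) (hβ : -1 < β) {c : ℕ → ℝ} (hc : JacobiNormalized α β c)
    (n : ℕ) : (jq α β c n).natDegree = n := by
  rw [jq, Polynomial.natDegree_C_mul (hc.1 n).ne', jP_natDegree hα hβ]

lemma jq_coeff_ne {α β : ℝ} (hα : -1 < α) (hβ : -1 < β) {c : ℕ → ℝ} (hc : JacobiNormalized α β c)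
    (n : ℕ) : (jq α β c n).coeff n ≠ 0 := by
  have h := jq_natDegree hα hβ hc n
  have h' : (jq α β c n).coeff n = (jq α β c n).leadingCoeff := by rw [Polynomial.leadingCoeff, h]
  rw [h', Polynomial.leadingCoeff_ne_zero]
  intro h0
  rcases Nat.eq_zero_or_pos n with rfl | hn
  · have := hc.2 0
    simp [nJ_eq, h0] at this
  · rw [h0] at h; simp at h; omega

lemma jnu_inj {α β : ℝ} (hα : -1 < α) (hβ : -1 < β) {n m : ℕ} (h : jnu α β n = jnu α β m) : n = m := by
  by_contra hne
  have h1 : ((n:ℝ) - m) * (n + m + α + β + 1) = 0 := by simp only [jnu] at h; linear_combination h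
  rcases mul_eq_zero.1 h1 with h2 | h2
  · exact hne (by exact_mod_cast sub_eq_zero.1 h2)
  · have : 1 ≤ n + m := by omega
    have : (1:ℝ) ≤ n + m := by exact_mod_cast this
    linarith

open Polynomial in
lemma jq_orth {α β : ℝ} (hα : -1 < α) (hβ : -1 < β) (c : ℕ → ℝ) {n m : ℕ} (h : n ≠ m) :
    ∫ θ, nJacobi α β c n θ * nJacobi α β c m θ ∂(jacobiMeasure α β) = 0 := by
  have h1 := jm_ibp hα hβ (jq α β c n) (jq α β c m)
  have h2 := jm_ibp hα hβ (jq α β c m) (jq α β c n)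
  rw [jq_ode hα hβ] at h1 h2
  have h3 : ∀ n m, ∫ θ, eval (Real.cos θ) (-C (jnu α β n) * jq α β c n * jq α β c m) ∂(jacobiMeasure α β) =
    - jnu α β n * ∫ θ, nJacobi α β c n θ * nJacobi α β c m θ ∂(jacobiMeasure α β) := by
    intro n m
    rw [← integral_const_mul]
    congr 1; ext θ
    simp only [nJ_eq, eval_mul, eval_neg, eval_C]; ring
  rw [h3] at h1 h2
  have h4 : ((1 - X^2) * derivative (jq α β c n) * derivative (jq α β c m)) =
    ((1 - X^2) * derivative (jq α β c m) * derivative (jq α β c n)) := by ring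
  rw [h4] at h1
  have h5 : ∫ θ, nJacobi α β c m θ * nJacobi α β c n θ ∂(jacobiMeasure α β) =
    ∫ θ, nJacobi α β c n θ * nJacobi α β c m θ ∂(jacobiMeasure α β) := by
    congr 1; ext θ; ring
  rw [h5] at h2
  have h6 : (jnu α β n - jnu α β m) *
    ∫ θ, nJacobi α β c n θ * nJacobi α β c m θ ∂(jacobiMeasure α β) = 0 := by
    linear_combination h2 - h1
  rcases mul_eq_zero.1 h6 with h7 | h7
  · exact absurd (jnu_inj hα hβ (sub_eq_zero.1 h7)) h
  · exact h7

lemma jq_orthonormal {α β : ℝ} (hα : -1 < α) (hβ : -1 < β) {c : ℕ → ℝ} (hc : JacobiNormalized α β c) (n m : ℕ) :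
    ∫ θ, nJacobi α β c n θ * nJacobi α β c m θ ∂(jacobiMeasure α β) = if n = m then 1 else 0 := by
  split_ifs with h
  · subst h
    rw [← hc.2 n]; congr 1; ext θ; ring
  · exact jq_orth hα hβ c h

open Polynomial in
lemma jq_grad {α β : ℝ} (hα : -1 < α) (hβ : -1 < β) {c : ℕ → ℝ} (hc : JacobiNormalized α β c) (n : ℕ) :
    ∫ θ, (Real.sin θ * (derivative (jq α β c n)).eval (Real.cos θ))^2 ∂(jacobiMeasure α β) = jnu α β n := by
  have h1 := jm_ibp hα hβ (jq α β c n) (jq α β c n)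
  rw [jq_ode hα hβ] at h1
  have h3 : ∫ θ, eval (Real.cos θ) (-C (jnu α β n) * jq α β c n * jq α β c n) ∂(jacobiMeasure α β) =
    - jnu α β n * ∫ θ, nJacobi α β c n θ ^2 ∂(jacobiMeasure α β) := by
    rw [← integral_const_mul]
    congr 1; ext θ
    simp only [nJ_eq, eval_mul, eval_neg, eval_C]; ring
  rw [h3, hc.2 n] at h1
  have h4 : ∀ θ, (Real.sin θ * (derivative (jq α β c n)).eval (Real.cos θ))^2 =
    eval (Real.cos θ) ((1 - X ^ 2) * derivative (jq α β c n) * derivative (jq α β c n)) := by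
    intro θ
    simp only [eval_mul, eval_sub, eval_pow, eval_X, eval_one]
    rw [← Real.sin_sq]; ring
  simp only [h4]
  linarith

open Polynomial in
lemma jq_span {α β : ℝ} (hα : -1 < α) (hβ : -1 < β) {c : ℕ → ℝ} (hc : JacobiNormalized α β c) (n : ℕ) :
    ∀ p : ℝ[X], p.degree < n → ∃ d : ℕ → ℝ, p = ∑ k ∈ Finset.range n, C (d k) * jq α β c k := by
  induction n with
  | zero => 
    intro p hp
    refine ⟨0, ?_⟩
    have : p = 0 := by
      rw [← degree_eq_bot]
      by_contra h
      have := natDegree_lt_iff_degree_lt (n := 0) (p := p) (by rintro rfl; simp at h)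
      simp at this hp; tauto
    simp [this]
  | succ n ih =>
    intro p hp
    set a := p.coeff n / (jq α β c n).coeff n
    have h : (p - C a * jq α β c n).degree < n := by
      rw [degree_lt_iff_coeff_zero]
      intro m hm
      rw [coeff_sub, coeff_C_mul]
      rcases hm.eq_or_lt with rfl | hm
      · simp only [a]
        rw [div_mul_cancel₀ _ (jq_coeff_ne hα hβ hc n), sub_self]
      · rw [degree_lt_iff_coeff_zero] at hp
        rw [hp m hm, coeff_eq_zero_of_natDegree_lt (by rw [jq_natDegree hα hβ hc]; exact hm)]
        simp
    obtain ⟨d, hd⟩ := ih _ h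
    refine ⟨fun k => if k = n then a else d k, ?_⟩
    rw [Finset.sum_range_succ, Finset.sum_congr rfl (g := fun k => C (d k) * jq α β c k), ← hd]
    · simp
    · intro k hk
      simp only [Finset.mem_range] at hk
      simp [hk.ne]

/-- inner product with a finite expansion -/
lemma jq_inner {α β : ℝ} (hα : -1 < α) (hβ : -1 < β) {c : ℕ → ℝ} (hc : JacobiNormalized α β c) (n m : ℕ)
    (d : ℕ → ℝ) (g : ℝ → ℝ) (hg : ∀ θ, g θ = ∑ k ∈ Finset.range n, d k * nJacobi α β c k θ) :
    ∫ θ, g θ * nJacobi α β c m θ ∂(jacobiMeasure α β) = if m < n then d m else 0 := by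
  have h : ∀ θ, g θ * nJacobi α β c m θ =
      ∑ k ∈ Finset.range n, d k * (nJacobi α β c k θ * nJacobi α β c m θ) := by
    intro θ; rw [hg, Finset.sum_mul]; exact Finset.sum_congr rfl fun k _ => by ring
  simp only [h]
  rw [integral_finsetSum]
  · simp only [integral_const_mul, jq_orthonormal hα hβ hc]
    simp
  · intro k _
    exact jm_integrable_cont hα hβ (continuous_const.mul ((nJ_cont _ _ _ _).mul (nJ_cont _ _ _ _)))

open Polynomial in
lemma jq_cos_expand {α β : ℝ} (hα : -1 < α) (hβ : -1 < β) {c : ℕ → ℝ} (hc : JacobiNormalized α β c) (n : ℕ) :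
    ∃ d : ℕ → ℝ, ∀ θ, Real.cos θ * nJacobi α β c n θ =
      ∑ k ∈ Finset.range (n+2), d k * nJacobi α β c k θ := by
  obtain ⟨d, hd⟩ := jq_span hα hβ hc (n+2) (X * jq α β c n) (by
    rw [degree_lt_iff_coeff_zero]
    intro m hm
    obtain ⟨k, rfl⟩ := Nat.exists_eq_add_of_le hm
    rw [show n + 2 + k = (n+1+k) + 1 by ring, coeff_X_mul]
    exact coeff_eq_zero_of_natDegree_lt (by rw [jq_natDegree hα hβ hc]; omega))
  refine ⟨d, fun θ => ?_⟩
  have := congrArg (eval (Real.cos θ)) hd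
  rw [eval_finsetSum] at this
  simpa [nJ_eq] using this

lemma jq_rec {α β : ℝ} (hα : -1 < α) (hβ : -1 < β) {c : ℕ → ℝ} (hc : JacobiNormalized α β c) :
    ∃ a b : ℕ → ℝ, (∀ n, |a n| ≤ 1) ∧
      (∀ θ, Real.cos θ * nJacobi α β c 0 θ = a 0 * nJacobi α β c 1 θ + b 0 * nJacobi α β c 0 θ) ∧
      (∀ n θ, Real.cos θ * nJacobi α β c (n+1) θ = a (n+1) * nJacobi α β c (n+2) θ +
        b (n+1) * nJacobi α β c (n+1) θ + a n * nJacobi α β c n θ) := by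
  choose d hd using jq_cos_expand hα hβ hc
  have hin := fun n m => jq_inner hα hβ hc (n+2) m (d n) _ (hd n)
  have hsymm : ∀ n m, m < n + 2 → d n m = if n < m + 2 then d m n else 0 := by
    intro n m h
    rw [← hin m n]
    have := hin n m
    rw [if_pos h] at this
    rw [← this]
    congr 1; ext θ; ring
  refine ⟨fun n => d n (n+1), fun n => d n n, ?_, ?_, ?_⟩
  · intro n
    have := hin n (n+1)
    rw [if_pos (by omega)] at this
    show |d n (n+1)| ≤ 1
    rw [← this, ← Real.norm_eq_abs]
    refine (norm_integral_le_integral_norm _).trans ?_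
    have hi : ∀ k, Integrable (fun θ => nJacobi α β c k θ ^2) (jacobiMeasure α β) := fun k =>
      jm_integrable_cont hα hβ ((nJ_cont _ _ _ _).pow 2)
    calc _ ≤ ∫ θ, (nJacobi α β c n θ ^2 + nJacobi α β c (n+1) θ ^2)/2 ∂(jacobiMeasure α β) := by
          refine integral_mono (jm_integrable_cont hα hβ ?_) (((hi n).add (hi (n+1))).div_const 2) fun θ => ?_
          · exact (((Real.continuous_cos.mul (nJ_cont _ _ _ _)).mul (nJ_cont _ _ _ _))).norm
          · simp only [Real.norm_eq_abs, abs_mul]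
            have h1 : |Real.cos θ| ≤ 1 := Real.abs_cos_le_one θ
            have h2 := abs_nonneg (nJacobi α β c n θ)
            have h3 := abs_nonneg (nJacobi α β c (n+1) θ)
            have h4 := sq_abs (nJacobi α β c n θ)
            have h5 := sq_abs (nJacobi α β c (n+1) θ)
            have h6 : |Real.cos θ| * |nJacobi α β c n θ| * |nJacobi α β c (n+1) θ| ≤
              1 * |nJacobi α β c n θ| * |nJacobi α β c (n+1) θ| := by gcongr
            nlinarith [sq_nonneg (|nJacobi α β c n θ| - |nJacobi α β c (n+1) θ|)]
      _ = 1 := by rw [integral_div, integral_add (hi _) (hi _), hc.2, hc.2]; norm_num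
  · intro θ
    rw [hd]; simp [Finset.sum_range_succ]; ring
  · intro n θ
    rw [hd, Finset.sum_range_succ, Finset.sum_range_succ, Finset.sum_range_succ, Finset.sum_eq_zero]
    · rw [hsymm (n+1) n (by omega), if_pos (by omega)]; ring
    · intro k hk
      simp only [Finset.mem_range] at hk
      rw [hsymm _ _ (by omega), if_neg (by omega), zero_mul]

end Part3

section Part4

/-- drift coefficient -/
def jb (α β θ : ℝ) : ℝ := (α - β + (α+β+1) * Real.cos θ) / Real.sin θ

lemma jb_contDiffOn (α β : ℝ) (k : ℕ) : ContDiffOn ℝ k (jb α β) (Ioo 0 π) := by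
  unfold jb
  refine ContDiffOn.div ?_ Real.contDiff_sin.contDiffOn fun x hx => (Real.sin_pos_of_mem_Ioo hx).ne'
  exact (contDiff_const.add (contDiff_const.mul Real.contDiff_cos)).contDiffOn

lemma jb_contDiffAt (α β : ℝ) (k : ℕ) {θ : ℝ} (h : θ ∈ Ioo 0 π) : ContDiffAt ℝ k (jb α β) θ :=
  (jb_contDiffOn α β k).contDiffAt (isOpen_Ioo.mem_nhds h)

lemma jb_bound (α β : ℝ) {A B : ℝ} (hA : 0 < A) (hB : B < π) (k : ℕ) :
    ∃ C, 0 ≤ C ∧ ∀ θ ∈ Icc A B, |iteratedDeriv k (jb α β) θ| ≤ C := by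
  have h1 : ContinuousOn (iteratedDeriv k (jb α β)) (Ioo 0 π) := by
    have := (jb_contDiffOn α β k).continuousOn_iteratedDerivWithin (m := k) le_rfl isOpen_Ioo.uniqueDiffOn
    exact this.congr fun x hx => (iteratedDerivWithin_of_isOpen isOpen_Ioo hx).symm
  obtain ⟨C, hC⟩ := isCompact_Icc.exists_bound_of_continuousOn
    (h1.mono (fun x (hx : x ∈ Icc A B) => ⟨by linarith [hx.1], by linarith [hx.2]⟩))
  exact ⟨max C 0, le_max_right _ _, fun θ h => (hC θ h).trans (le_max_left _ _)⟩

lemma nJ_contDiff (α β : ℝ) (c : ℕ → ℝ) (n : ℕ) (k : WithTop ℕ∞) : ContDiff ℝ k (nJacobi α β c n) := by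
  have : nJacobi α β c n = fun θ => (jq α β c n).eval (Real.cos θ) := funext (nJ_eq α β c n)
  rw [this]
  have h := (Polynomial.contDiff_aeval (𝕜 := ℝ) (jq α β c n) k).comp Real.contDiff_cos
  simpa [Function.comp_def, Polynomial.coe_aeval_eq_eval] using h

open Polynomial in
lemma nJ_hasDerivAt (α β : ℝ) (c : ℕ → ℝ) (n : ℕ) (θ : ℝ) :
    HasDerivAt (nJacobi α β c n) (-(Real.sin θ * (derivative (jq α β c n)).eval (Real.cos θ))) θ := by
  have : nJacobi α β c n = fun θ => (jq α β c n).eval (Real.cos θ) := funext (nJ_eq α β c n)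
  rw [this]
  have := HasDerivAt.comp (h₂ := fun x => (jq α β c n).eval x) θ
        ((jq α β c n).hasDerivAt _) (Real.hasDerivAt_cos θ)
  refine this.congr_deriv (by ring)

open Polynomial in
lemma nJ_deriv (α β : ℝ) (c : ℕ → ℝ) (n : ℕ) :
    deriv (nJacobi α β c n) = fun θ => (-(Real.sin θ * (derivative (jq α β c n)).eval (Real.cos θ))) :=
  funext fun θ => (nJ_hasDerivAt α β c n θ).deriv

open Polynomial in
lemma nJ_ode {α β : ℝ} (hα : -1 < α) (hβ : -1 < β) (c : ℕ → ℝ) (n : ℕ) {θ : ℝ} (h : θ ∈ Ioo 0 π) :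
    HasDerivAt (deriv (nJacobi α β c n))
      (-(jb α β θ * deriv (nJacobi α β c n) θ) - jnu α β n * nJacobi α β c n θ) θ := by
  rw [nJ_deriv]
  have h1 := HasDerivAt.comp (h₂ := fun x => (derivative (jq α β c n)).eval x) θ
        ((derivative (jq α β c n)).hasDerivAt _) (Real.hasDerivAt_cos θ)
  refine (((Real.hasDerivAt_sin θ).mul h1).neg).congr_deriv ?_
  have h2 := congrArg (eval (Real.cos θ)) (jq_ode hα hβ c n)
  simp only [jL, eval_add, eval_mul, eval_sub, eval_pow, eval_one, eval_X, eval_C, eval_neg] at h2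
  rw [nJ_eq]
  have hs := (Real.sin_pos_of_mem_Ioo h).ne'
  have e := Real.sin_sq θ
  simp only [jb, Function.comp_apply]
  field_simp
  rw [← e] at h2
  linear_combination h2

lemma nJ_cont_deriv (α β : ℝ) (c : ℕ → ℝ) (n : ℕ) : Continuous (deriv (nJacobi α β c n)) := by
  rw [nJ_deriv]
  exact (Real.continuous_sin.mul ((Polynomial.continuous _).comp Real.continuous_cos)).neg

/-- energy -/
def jE (α β : ℝ) (c : ℕ → ℝ) (n : ℕ) (θ : ℝ) : ℝ :=
  (deriv (nJacobi α β c n) θ)^2 + ((n:ℝ)+1)^2 * (nJacobi α β c n θ)^2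

lemma jE_cont (α β : ℝ) (c : ℕ → ℝ) (n : ℕ) : Continuous (jE α β c n) :=
  ((nJ_cont_deriv α β c n).pow 2).add (continuous_const.mul ((nJ_cont α β c n).pow 2))

lemma jE_integral {α β : ℝ} (hα : -1 < α) (hβ : -1 < β) {c : ℕ → ℝ} (hc : JacobiNormalized α β c) (n : ℕ) :
    ∫ θ, jE α β c n θ ∂(jacobiMeasure α β) = jnu α β n + ((n:ℝ)+1)^2 := by
  unfold jE
  have i1 : Integrable (fun θ => (deriv (nJacobi α β c n) θ)^2) (jacobiMeasure α β) :=
    jm_integrable_cont hα hβ ((nJ_cont_deriv α β c n).pow 2)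
  have i2 : Integrable (fun θ => ((n:ℝ)+1)^2 * (nJacobi α β c n θ)^2) (jacobiMeasure α β) :=
    jm_integrable_cont hα hβ (continuous_const.mul ((nJ_cont α β c n).pow 2))
  rw [integral_add i1 i2, integral_const_mul,
    hc.2 n, ← jq_grad hα hβ hc n, nJ_deriv]
  simp

lemma jE_gronwall {α β : ℝ} (hα : -1 < α) (hβ : -1 < β) (c : ℕ → ℝ) 
    {A B : ℝ} (hA : 0 < A) (hB : B < π) :
    ∃ M, 0 ≤ M ∧ ∀ n, ∀ θ ∈ Icc A B, ∀ φ ∈ Icc A B, jE α β c n θ ≤ M * jE α β c n φ := by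
  obtain ⟨C, hC0, hC⟩ := jb_bound α β hA hB 0
  simp only [iteratedDeriv_zero] at hC
  set K : ℝ := 2 + |α+β+1| with hK
  set M : ℝ := 2 * C + K with hM
  have hsub : ∀ x ∈ Icc A B, x ∈ Ioo 0 π := fun x hx => ⟨by linarith [hx.1], by linarith [hx.2]⟩
  have hd : ∀ n, ∀ θ ∈ Icc A B, ∃ D, HasDerivAt (jE α β c n) D θ ∧ |D| ≤ M * jE α β c n θ := by
    intro n θ hθ
    have h1 := nJ_ode hα hβ c n (hsub θ hθ)
    have h2 : HasDerivAt (nJacobi α β c n) (deriv (nJacobi α β c n) θ) θ :=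
      ((nJ_contDiff α β c n 1).differentiable one_ne_zero θ).hasDerivAt
    refine ⟨_, (h1.pow 2).add ((h2.pow 2).const_mul _), ?_⟩
    simp only [jE]
    set y := nJacobi α β c n θ
    set y' := deriv (nJacobi α β c n) θ
    have e : ((2:ℕ):ℝ) * y' ^ (2-1) * (-(jb α β θ * y') - jnu α β n * y) + ((n:ℝ)+1)^2 * ((2:ℕ) * y^(2-1) * y') =
      -2 * jb α β θ * y'^2 + 2 * (((n:ℝ)+1)^2 - jnu α β n) * (y * y') := by
      push_cast; ring
    rw [e]
    have hb := hC θ hθ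
    have hn : |((n:ℝ)+1)^2 - jnu α β n| ≤ K * (n+1) := by
      have e : ((n:ℝ)+1)^2 - jnu α β n = 2 * n + 1 - n * (α+β+1) := by simp only [jnu]; ring
      rw [e]
      have hn : (0:ℝ) ≤ n := Nat.cast_nonneg n
      have h1 := neg_abs_le (α+β+1)
      have h2 := le_abs_self (α+β+1)
      have h3 := abs_nonneg (α+β+1)
      rw [abs_le]; constructor <;> simp only [hK] <;> nlinarith
    calc _ ≤ |-2 * jb α β θ * y'^2| + |2 * (((n:ℝ)+1)^2 - jnu α β n) * (y * y')| := abs_add_le _ _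
      _ = 2 * |jb α β θ| * y'^2 + 2 * |((n:ℝ)+1)^2 - jnu α β n| * (|y| * |y'|) := by
        simp only [abs_mul, abs_neg, abs_two, abs_pow, sq_abs]
      _ ≤ 2 * C * y'^2 + 2 * (K * (n+1)) * (|y| * |y'|) := by gcongr
      _ ≤ _ := by
        have hK0 : 0 ≤ K := by positivity
        have h5 := sq_abs y
        have h6 := sq_abs y'
        have : 2 * ((n:ℝ)+1) * (|y| * |y'|) ≤ y'^2 + ((n:ℝ)+1)^2 * y^2 := by
          rw [← h5, ← h6]; nlinarith [sq_nonneg (|y'| - ((n:ℝ)+1) * |y|)]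
        have h7 : 0 ≤ 2 * C * (((n:ℝ)+1)^2 * y^2) := by positivity
        simp only [hM]
        nlinarith [mul_le_mul_of_nonneg_left this hK0]
  have hE0 : ∀ n θ, 0 ≤ jE α β c n θ := fun n θ => by unfold jE; positivity
  refine ⟨Real.exp (M * (B - A)), (Real.exp_pos _).le, fun n θ hθ φ hφ => ?_⟩
  have hM0 : 0 ≤ M := by positivity
  choose! D hD hDb using hd n
  have hexp : ∀ s x : ℝ, HasDerivAt (fun x => Real.exp (s * x)) (Real.exp (s * x) * (s * 1)) x := fun s x =>
    ((hasDerivAt_id x).const_mul s).exp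
  rcases le_total θ φ with h | h
  · -- E e^{Mθ} is monotone
    have mono : MonotoneOn (fun x => Real.exp (M * x) * jE α β c n x) (Icc A B) := by
      refine monotoneOn_of_hasDerivWithinAt_nonneg (convex_Icc _ _) ?_ 
        (f' := fun x => Real.exp (M * x) * (M * 1) * jE α β c n x + Real.exp (M*x) * D x) ?_ ?_
      · exact ((by fun_prop : Continuous fun x => Real.exp (M * x)).mul (jE_cont _ _ _ _)).continuousOn
      · intro x hx
        exact ((hexp M x).mul (hD x (interior_subset hx))).hasDerivWithinAt
      · intro x hx
        have := (abs_le.1 (hDb x (interior_subset hx))).1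
        have h2 := Real.exp_pos (M*x)
        nlinarith
    have := mono hθ hφ h
    simp only at this
    have h3 : jE α β c n θ ≤ Real.exp (M * (φ - θ)) * jE α β c n φ := by
      have e : Real.exp (M * φ) = Real.exp (M*θ) * Real.exp (M * (φ - θ)) := by
        rw [← Real.exp_add]; ring_nf
      rw [e, mul_assoc] at this
      exact le_of_mul_le_mul_left this (Real.exp_pos _)
    refine h3.trans (mul_le_mul_of_nonneg_right (Real.exp_le_exp.2 ?_) (hE0 _ _))
    exact mul_le_mul_of_nonneg_left (by linarith [hθ.1, hφ.2]) hM0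
  · have mono : AntitoneOn (fun x => Real.exp ((-M) * x) * jE α β c n x) (Icc A B) := by
      refine antitoneOn_of_hasDerivWithinAt_nonpos (convex_Icc _ _) ?_ 
        (f' := fun x => Real.exp ((-M) * x) * (-M * 1) * jE α β c n x + Real.exp ((-M)*x) * D x) ?_ ?_
      · exact ((by fun_prop : Continuous fun x => Real.exp ((-M) * x)).mul (jE_cont _ _ _ _)).continuousOn
      · intro x hx
        exact ((hexp (-M) x).mul (hD x (interior_subset hx))).hasDerivWithinAt
      · intro x hx
        have := (abs_le.1 (hDb x (interior_subset hx))).2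
        have h2 := Real.exp_pos ((-M)*x)
        nlinarith
    have := mono hφ hθ h
    simp only at this
    have h3 : jE α β c n θ ≤ Real.exp (M * (θ - φ)) * jE α β c n φ := by
      have e : Real.exp (-M * φ) = Real.exp (-M*θ) * Real.exp (M * (θ - φ)) := by
        rw [← Real.exp_add]; ring_nf
      rw [e, mul_assoc] at this
      exact le_of_mul_le_mul_left this (Real.exp_pos _)
    refine h3.trans (mul_le_mul_of_nonneg_right (Real.exp_le_exp.2 ?_) (hE0 _ _))
    exact mul_le_mul_of_nonneg_left (by linarith [hφ.1, hθ.2]) hM0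

lemma jE_bound {α β : ℝ} (hα : -1 < α) (hβ : -1 < β) {c : ℕ → ℝ} (hc : JacobiNormalized α β c)
    {A B : ℝ} (hA : 0 < A) (hAB : A < B) (hB : B < π) :
    ∃ M, 0 ≤ M ∧ ∀ n, ∀ θ ∈ Icc A B, jE α β c n θ ≤ M * ((n:ℝ)+1)^2 := by
  have := jm_finite hα hβ
  obtain ⟨M, hM0, hM⟩ := jE_gronwall hα hβ c hA hB
  set m := (jacobiMeasure α β).real (Icc A B) with hm
  have hmpos : 0 < m := by
    rw [hm, measureReal_def, ENNReal.toReal_pos_iff]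
    refine ⟨pos_iff_ne_zero.2 fun h => ?_, measure_lt_top _ _⟩
    have h1 : ∀ᵐ θ ∂(jacobiMeasure α β), θ ∉ Icc A B := measure_eq_zero_iff_ae_notMem.1 h
    have h2 := jm_ae_of_ae h1
    have hsub : Icc A B ⊆ Ioo 0 π := fun x hx => ⟨by linarith [hx.1], by linarith [hx.2]⟩
    rw [← measure_eq_zero_iff_ae_notMem, Measure.restrict_apply measurableSet_Icc,
      inter_eq_self_of_subset_left hsub] at h2
    simp at h2; linarith
  have hE0 : ∀ n θ, 0 ≤ jE α β c n θ := fun n θ => by unfold jE; positivity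
  refine ⟨M / m * (2 + |α+β+1|), by positivity, fun n θ hθ => ?_⟩
  have hi : Integrable (jE α β c n) (jacobiMeasure α β) := jm_integrable_cont hα hβ (jE_cont _ _ _ _)
  have h1 : m * jE α β c n θ ≤ M * (jnu α β n + ((n:ℝ)+1)^2) := by
    calc m * jE α β c n θ = ∫ φ in Icc A B, jE α β c n θ ∂(jacobiMeasure α β) := by simp [hm]
      _ ≤ ∫ φ in Icc A B, M * jE α β c n φ ∂(jacobiMeasure α β) := by
        refine setIntegral_mono_on (by simp) (hi.const_mul M).integrableOn measurableSet_Icc ?_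
        intro φ hφ; exact hM n θ hθ φ hφ
      _ ≤ ∫ φ, M * jE α β c n φ ∂(jacobiMeasure α β) := by
        refine setIntegral_le_integral (hi.const_mul M) (Eventually.of_forall fun φ => ?_)
        exact mul_nonneg hM0 (hE0 n φ)
      _ = _ := by rw [integral_const_mul, jE_integral hα hβ hc]
  have h2 : jnu α β n + ((n:ℝ)+1)^2 ≤ (2 + |α+β+1|) * ((n:ℝ)+1)^2 := by
    have hn : (0:ℝ) ≤ n := Nat.cast_nonneg n
    have h2 := le_abs_self (α+β+1)
    have h3 := abs_nonneg (α+β+1)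
    simp only [jnu]
    nlinarith [mul_nonneg hn h3, mul_nonneg hn hn, mul_nonneg (mul_nonneg hn hn) h3, mul_le_mul_of_nonneg_left h2 hn]
  rw [← mul_le_mul_iff_right₀ hmpos]
  calc _ ≤ _ := h1
    _ ≤ M * ((2 + |α+β+1|) * ((n:ℝ)+1)^2) := by gcongr
    _ = _ := by field_simp

lemma iter_ode {α β : ℝ} (hα : -1 < α) (hβ : -1 < β) (c : ℕ → ℝ) (n k : ℕ) {θ : ℝ} (h : θ ∈ Ioo 0 π) :
    iteratedDeriv (k+2) (nJacobi α β c n) θ = - (∑ i ∈ Finset.range (k+1),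
      k.choose i * iteratedDeriv i (jb α β) θ * iteratedDeriv (k-i+1) (nJacobi α β c n) θ) -
        jnu α β n * iteratedDeriv k (nJacobi α β c n) θ := by
  rw [iteratedDeriv_succ', iteratedDeriv_succ']
  have h1 : deriv (deriv (nJacobi α β c n)) =ᶠ[nhds θ]
      (- (jb α β * deriv (nJacobi α β c n))) - (fun x => jnu α β n * nJacobi α β c n x) := by
    filter_upwards [isOpen_Ioo.mem_nhds h] with x hx
    rw [(nJ_ode hα hβ c n hx).deriv]; rfl
  have hd : ContDiff ℝ k (deriv (nJacobi α β c n)) :=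
    (contDiff_succ_iff_deriv.1 (nJ_contDiff α β c n (k+1))).2.2
  have hbd : ContDiffAt ℝ k (-(jb α β * deriv (nJacobi α β c n))) θ :=
    ((jb_contDiffAt α β k h).mul hd.contDiffAt).neg
  have hbe : ContDiffAt ℝ k (fun x => jnu α β n * nJacobi α β c n x) θ :=
    (contDiff_const.mul (nJ_contDiff α β c n k)).contDiffAt
  rw [h1.iteratedDeriv_eq k, iteratedDeriv_sub hbd hbe, iteratedDeriv_neg,
    iteratedDeriv_mul (jb_contDiffAt α β k h) hd.contDiffAt]
  simp only [← iteratedDeriv_succ', iteratedDeriv_const_mul_field]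

lemma jnu_le (α β : ℝ) (n : ℕ) : |jnu α β n| ≤ (1 + |α+β+1|) * ((n:ℝ)+1)^2 := by
  have hn : (0:ℝ) ≤ n := Nat.cast_nonneg n
  have h1 : |jnu α β n| ≤ n * (n + |α+β+1|) := by
    rw [jnu, abs_mul, abs_of_nonneg hn, add_assoc, add_assoc, ← add_assoc α]
    gcongr
    exact (abs_add_le _ _).trans (by rw [abs_of_nonneg hn])
  have h3 := abs_nonneg (α+β+1)
  nlinarith [mul_nonneg hn h3, mul_nonneg hn hn, mul_nonneg (mul_nonneg hn hn) h3]

lemma nJ_bound {α β : ℝ} (hα : -1 < α) (hβ : -1 < β) {c : ℕ → ℝ} (hc : JacobiNormalized α β c)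
    {A B : ℝ} (hA : 0 < A) (hAB : A < B) (hB : B < π) (k : ℕ) :
    ∃ M, 0 ≤ M ∧ ∀ n, ∀ θ ∈ Icc A B, |iteratedDeriv k (nJacobi α β c n) θ| ≤ M * ((n:ℝ)+1)^k := by
  induction k using Nat.strong_induction_on with
  | _ k ih =>
  obtain ⟨M, hM0, hM⟩ := jE_bound hα hβ hc hA hAB hB
  rcases k with _ | _ | k
  · refine ⟨Real.sqrt M, Real.sqrt_nonneg _, fun n θ hθ => ?_⟩
    simp only [iteratedDeriv_zero, pow_zero, mul_one]
    apply Real.abs_le_sqrt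
    have := hM n θ hθ
    simp only [jE] at this
    have hn : 0 < ((n:ℝ)+1)^2 := by positivity
    rw [← mul_le_mul_iff_right₀ hn]
    nlinarith [sq_nonneg (deriv (nJacobi α β c n) θ)]
  · refine ⟨Real.sqrt M, Real.sqrt_nonneg _, fun n θ hθ => ?_⟩
    simp only [zero_add, iteratedDeriv_one, pow_one]
    have hn : 0 ≤ (n:ℝ)+1 := by positivity
    rw [← Real.sqrt_sq hn, ← Real.sqrt_mul hM0]
    apply Real.abs_le_sqrt
    have := hM n θ hθ
    simp only [jE] at this
    nlinarith [mul_nonneg (sq_nonneg ((n:ℝ)+1)) (sq_nonneg (nJacobi α β c n θ))]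
  · choose Cb hCb0 hCb using fun i => jb_bound α β hA hB i
    choose! Cm hCm0 hCm using ih
    refine ⟨∑ i ∈ Finset.range (k+1), k.choose i * Cb i * Cm (k-i+1) + (1 + |α+β+1|) * Cm k, ?_, ?_⟩
    · have := hCm0 k (by omega)
      refine add_nonneg (Finset.sum_nonneg fun i hi => ?_) (by positivity)
      have := hCm0 (k-i+1) (by omega)
      have := hCb0 i
      positivity
    intro n θ hθ
    have hn1 : (1:ℝ) ≤ (n:ℝ)+1 := by linarith [(Nat.cast_nonneg n : (0:ℝ) ≤ n)]
    rw [iter_ode hα hβ c n k ⟨by linarith [hθ.1], by linarith [hθ.2]⟩]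
    refine (abs_sub _ _).trans ?_
    rw [abs_neg, add_mul, abs_mul, Finset.sum_mul]
    refine add_le_add ((Finset.abs_sum_le_sum_abs _ _).trans (Finset.sum_le_sum fun i hi => ?_)) ?_
    · have h2 := hCb i θ hθ
      have h3 := hCm (k-i+1) (by omega) n θ hθ
      have h4 := hCm0 (k-i+1) (by omega)
      have h5 := hCb0 i
      rw [abs_mul, abs_mul, Nat.abs_cast]
      calc _ ≤ k.choose i * Cb i * (Cm (k-i+1) * ((n:ℝ)+1)^(k-i+1)) := by gcongr
        _ ≤ k.choose i * Cb i * (Cm (k-i+1) * ((n:ℝ)+1)^(k+2)) := by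
          gcongr 4
          · exact Nat.sub_le k i
          · norm_num
        _ = _ := by ring
    · have h2 := jnu_le α β n
      have h3 := hCm k (by omega) n θ hθ
      calc _ ≤ (1 + |α+β+1|) * ((n:ℝ)+1)^2 * (Cm k * ((n:ℝ)+1)^k) := by gcongr
        _ = _ := by ring

end Part4

section Part5

/-- eigenvalue root -/
def jl (α β : ℝ) (n : ℕ) : ℝ := |(n:ℝ) + jacobiTau α β|

lemma jtau_gt {α β : ℝ} (hα : -1 < α) (hβ : -1 < β) : -(1/2) < jacobiTau α β := by
  unfold jacobiTau; linarith

lemma jl_nonneg (α β : ℝ) (n : ℕ) : 0 ≤ jl α β n := abs_nonneg _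

lemma jl_eq {α β : ℝ} (hα : -1 < α) (hβ : -1 < β) {n : ℕ} (hn : 1 ≤ n) : jl α β n = n + jacobiTau α β := by
  have := jtau_gt hα hβ
  have h : (1:ℝ) ≤ n := by exact_mod_cast hn
  exact abs_of_nonneg (by linarith)

lemma jl_lower {α β : ℝ} (hα : -1 < α) (hβ : -1 < β) {n : ℕ} (hn : 1 ≤ n) : ((n:ℝ)+1)/4 ≤ jl α β n := by
  have := jtau_gt hα hβ
  have h : (1:ℝ) ≤ n := by exact_mod_cast hn
  rw [jl_eq hα hβ hn]; linarith

lemma jl_lower' {α β : ℝ} (hα : -1 < α) (hβ : -1 < β) (n : ℕ) : ((n:ℝ)+1)/4 - 1 ≤ jl α β n := by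
  have := jtau_gt hα hβ
  have h : (0:ℝ) ≤ n := by positivity
  refine le_trans ?_ (le_abs_self _); linarith

lemma jl_upper (α β : ℝ) (n : ℕ) : jl α β n ≤ (1 + |jacobiTau α β|) * ((n:ℝ)+1) := by
  have h : (0:ℝ) ≤ n := by positivity
  refine (abs_add_le _ _).trans ?_
  rw [abs_of_nonneg h]
  nlinarith [abs_nonneg (jacobiTau α β)]

lemma jnu_eq (α β : ℝ) (n : ℕ) : jnu α β n = (jl α β n)^2 - (jacobiTau α β)^2 := by
  rw [jl, sq_abs, jnu, jacobiTau]; ring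

lemma nJ_bound_at {α β : ℝ} (hα : -1 < α) (hβ : -1 < β) {c : ℕ → ℝ} (hc : JacobiNormalized α β c)
    {θ : ℝ} (hθ : θ ∈ Ioo 0 π) (k : ℕ) :
    ∃ M, 0 ≤ M ∧ ∀ n, |iteratedDeriv k (nJacobi α β c n) θ| ≤ M * ((n:ℝ)+1)^k := by
  obtain ⟨M, h0, h⟩ := nJ_bound hα hβ hc (A := θ/2) (B := (θ+π)/2) (by linarith [hθ.1]) 
    (by linarith [Real.pi_pos]) (by linarith [hθ.2]) k
  exact ⟨M, h0, fun n => h n θ ⟨by linarith [hθ.1], by linarith [hθ.2]⟩⟩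

lemma nJ_bound0 {α β : ℝ} (hα : -1 < α) (hβ : -1 < β) {c : ℕ → ℝ} (hc : JacobiNormalized α β c)
    {θ : ℝ} (hθ : θ ∈ Ioo 0 π) :
    ∃ M, 0 ≤ M ∧ ∀ n, |nJacobi α β c n θ| ≤ M := by
  simpa using nJ_bound_at hα hβ hc hθ 0

lemma iter_two {α β : ℝ} (hα : -1 < α) (hβ : -1 < β) {c : ℕ → ℝ} (hc : JacobiNormalized α β c)
    {θ : ℝ} (hθ : θ ∈ Ioo 0 π) (k : ℕ) :
    ∃ M, 0 ≤ M ∧ ∀ n, |iteratedDeriv (k+2) (nJacobi α β c n) θ + (jl α β n)^2 * iteratedDeriv k (nJacobi α β c n) θ|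
      ≤ M * ((n:ℝ)+1)^(k+1) := by
  choose Cm hCm0 hCm using fun j => nJ_bound_at hα hβ hc hθ j
  refine ⟨∑ i ∈ Finset.range (k+1), k.choose i * |iteratedDeriv i (jb α β) θ| * Cm (k-i+1) + (jacobiTau α β)^2 * Cm k, ?_, ?_⟩
  · have := hCm0 k
    refine add_nonneg (Finset.sum_nonneg fun i hi => ?_) (by positivity)
    have := hCm0 (k-i+1)
    positivity
  intro n
  have hn1 : (1:ℝ) ≤ (n:ℝ)+1 := by linarith [(Nat.cast_nonneg n : (0:ℝ) ≤ n)]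
  rw [iter_ode hα hβ c n k hθ, jnu_eq]
  have e : ∀ S D : ℝ, - S - ((jl α β n)^2 - (jacobiTau α β)^2) * D + (jl α β n)^2 * D = -S + (jacobiTau α β)^2 * D := by
    intros; ring
  rw [e]
  refine (abs_add_le _ _).trans ?_
  rw [abs_neg, add_mul, abs_mul, Finset.sum_mul]
  refine add_le_add ((Finset.abs_sum_le_sum_abs _ _).trans (Finset.sum_le_sum fun i hi => ?_)) ?_
  · have h3 := hCm (k-i+1) n
    have h4 := hCm0 (k-i+1)
    rw [abs_mul, abs_mul, Nat.abs_cast]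
    calc _ ≤ k.choose i * |iteratedDeriv i (jb α β) θ| * (Cm (k-i+1) * ((n:ℝ)+1)^(k-i+1)) := by gcongr
      _ ≤ k.choose i * |iteratedDeriv i (jb α β) θ| * (Cm (k-i+1) * ((n:ℝ)+1)^(k+1)) := by
        have := pow_le_pow_right₀ hn1 (show k-i+1 ≤ k+1 by omega)
        gcongr 3
      _ = _ := by ring
  · have h3 := hCm k n
    have h4 := hCm0 k
    rw [abs_of_nonneg (sq_nonneg _)]
    calc _ ≤ (jacobiTau α β)^2 * (Cm k * ((n:ℝ)+1)^k) := by gcongr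
      _ ≤ (jacobiTau α β)^2 * (Cm k * ((n:ℝ)+1)^(k+1)) := by
        have := pow_le_pow_right₀ hn1 (show k ≤ k+1 by omega)
        gcongr 3
      _ = _ := by ring

lemma rem_bound {α β : ℝ} (hα : -1 < α) (hβ : -1 < β) {c : ℕ → ℝ} (hc : JacobiNormalized α β c)
    {θ : ℝ} (hθ : θ ∈ Ioo 0 π) (m : ℕ) :
    ∃ M, 0 ≤ M ∧ ∀ n, |iteratedDeriv (2*m) (nJacobi α β c n) θ - (-1)^m * (jl α β n)^(2*m) * nJacobi α β c n θ| * ((n:ℝ)+1)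
      ≤ M * ((n:ℝ)+1)^(2*m) := by
  induction m with
  | zero => exact ⟨0, le_rfl, fun n => by simp⟩
  | succ m ih =>
    obtain ⟨M, hM0, hM⟩ := ih
    obtain ⟨K, hK0, hK⟩ := iter_two hα hβ hc hθ (2*m)
    set L := 1 + |jacobiTau α β|
    refine ⟨K + L^2 * M, by positivity, fun n => ?_⟩
    have hn1 : (0:ℝ) ≤ (n:ℝ)+1 := by positivity
    have e : iteratedDeriv (2*(m+1)) (nJacobi α β c n) θ - (-1)^(m+1) * (jl α β n)^(2*(m+1)) * nJacobi α β c n θ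
      = (iteratedDeriv (2*m+2) (nJacobi α β c n) θ + (jl α β n)^2 * iteratedDeriv (2*m) (nJacobi α β c n) θ)
       - (jl α β n)^2 * (iteratedDeriv (2*m) (nJacobi α β c n) θ - (-1)^m * (jl α β n)^(2*m) * nJacobi α β c n θ) := by
      rw [show 2*(m+1) = 2*m+2 by ring]; ring
    rw [e]
    have h1 := jl_upper α β n
    have h0 := jl_nonneg α β n
    calc _ ≤ (|iteratedDeriv (2*m+2) (nJacobi α β c n) θ + (jl α β n)^2 * iteratedDeriv (2*m) (nJacobi α β c n) θ|
         + (jl α β n)^2 * |(iteratedDeriv (2*m) (nJacobi α β c n) θ - (-1)^m * (jl α β n)^(2*m) * nJacobi α β c n θ)|) * ((n:ℝ)+1) := by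
          refine mul_le_mul_of_nonneg_right ((abs_sub _ _).trans ?_) hn1
          rw [abs_mul, abs_of_nonneg (sq_nonneg (jl α β n))]
      _ = |iteratedDeriv (2*m+2) (nJacobi α β c n) θ + (jl α β n)^2 * iteratedDeriv (2*m) (nJacobi α β c n) θ| * ((n:ℝ)+1)
         + (jl α β n)^2 * (|(iteratedDeriv (2*m) (nJacobi α β c n) θ - (-1)^m * (jl α β n)^(2*m) * nJacobi α β c n θ)| * ((n:ℝ)+1)) := by ring
      _ ≤ (K * ((n:ℝ)+1)^(2*m+1)) * ((n:ℝ)+1) + (L * ((n:ℝ)+1))^2 * (M * ((n:ℝ)+1)^(2*m)) := by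
          refine add_le_add (mul_le_mul_of_nonneg_right (hK n) hn1) (mul_le_mul (pow_le_pow_left₀ h0 h1 2) (hM n) ?_ ?_) <;> positivity
      _ = _ := by ring

lemma exp_jl_le {α β : ℝ} (hα : -1 < α) (hβ : -1 < β) {t : ℝ} (ht : 0 < t) (n : ℕ) :
    Real.exp (-t * jl α β n) ≤ Real.exp t * Real.exp (-(t/4) * ((n:ℝ)+1)) := by
  rw [← Real.exp_add]
  apply Real.exp_le_exp.2
  nlinarith [jl_lower' hα hβ n]

lemma summable_pow_exp {s : ℝ} (hs : 0 < s) (k : ℕ) : 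
    Summable fun n : ℕ => ((n:ℝ)+1)^k * Real.exp (-s * ((n:ℝ)+1)) := by
  have := (summable_nat_add_iff 1).2 (Real.summable_pow_mul_exp_neg_nat_mul k hs)
  simpa using this

lemma summable_exp_jl {α β : ℝ} (hα : -1 < α) (hβ : -1 < β) {t : ℝ} (ht : 0 < t) (k : ℕ) (C : ℝ) :
    Summable fun n : ℕ => C * (((n:ℝ)+1)^k * Real.exp (-t * jl α β n)) := by
  refine Summable.mul_left _ (Summable.of_nonneg_of_le (fun n => by positivity) (fun n => ?_)
    ((summable_pow_exp (s := t/4) (by positivity) k).mul_left (Real.exp t)))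
  have := exp_jl_le hα hβ ht n
  calc _ ≤ ((n:ℝ)+1)^k * (Real.exp t * Real.exp (-(t/4) * ((n:ℝ)+1))) := by gcongr
    _ = _ := by ring

/-- Term-by-term differentiation of the Poisson kernel. -/
lemma poisson_deriv {α β : ℝ} (hα : -1 < α) (hβ : -1 < β) {c : ℕ → ℝ} (hc : JacobiNormalized α β c)
    {θ φ : ℝ} (hθ : θ ∈ Ioo 0 π) (hφ : φ ∈ Ioo 0 π) {t : ℝ} (ht : 0 < t) (k : ℕ) :
    iteratedDeriv k (fun θ' => poissonKer α β c t θ' φ) θ = 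
      ∑' n : ℕ, Real.exp (-t * jl α β n) * iteratedDeriv k (nJacobi α β c n) θ * nJacobi α β c n φ := by
  obtain ⟨P, hP0, hP⟩ := nJ_bound0 hα hβ hc hφ
  set A := θ/2
  set B := (θ+π)/2
  have hA : 0 < A := by simp only [A]; linarith [hθ.1]
  have hAB : A < B := by simp only [A, B]; linarith [Real.pi_pos]
  have hB : B < π := by simp only [B]; linarith [hθ.2]
  have hθ' : θ ∈ Ioo A B := ⟨by simp only [A]; linarith [hθ.1], by simp only [B]; linarith [hθ.2]⟩
  choose Cm hCm0 hCm using fun j => nJ_bound hα hβ hc hA hAB hB j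
  have key : ∀ j, ∀ n, ∀ x ∈ Ioo A B, |Real.exp (-t * jl α β n) * iteratedDeriv j (nJacobi α β c n) x * nJacobi α β c n φ|
      ≤ Cm j * P * (((n:ℝ)+1)^j * Real.exp (-t * jl α β n)) := by
    intro j n x hx
    rw [abs_mul, abs_mul, abs_of_nonneg (Real.exp_pos _).le]
    have h1 := hCm j n x (Ioo_subset_Icc_self hx)
    calc _ ≤ Real.exp (-t * jl α β n) * (Cm j * ((n:ℝ)+1)^j) * P := by 
            have := hCm0 j
            gcongr
            exact hP n
      _ = _ := by ring
  have main : ∀ j, ∀ x ∈ Ioo A B, iteratedDeriv j (fun θ' => poissonKer α β c t θ' φ) x = 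
      ∑' n : ℕ, Real.exp (-t * jl α β n) * iteratedDeriv j (nJacobi α β c n) x * nJacobi α β c n φ := by
    intro j
    induction j with
    | zero => intro x hx; simp [poissonKer, jl]
    | succ j ih =>
      intro x hx
      rw [iteratedDeriv_succ]
      have h1 : iteratedDeriv j (fun θ' => poissonKer α β c t θ' φ) =ᶠ[nhds x] fun y =>
        ∑' n : ℕ, Real.exp (-t * jl α β n) * iteratedDeriv j (nJacobi α β c n) y * nJacobi α β c n φ := by
        filter_upwards [isOpen_Ioo.mem_nhds hx] with y hy using ih y hy
      rw [h1.deriv_eq]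
      refine HasDerivAt.deriv ?_
      refine hasDerivAt_tsum_of_isPreconnected (summable_exp_jl hα hβ ht (j+1) (Cm (j+1) * P)) isOpen_Ioo
        isPreconnected_Ioo
        (g' := fun n y => Real.exp (-t * jl α β n) * iteratedDeriv (j+1) (nJacobi α β c n) y * nJacobi α β c n φ) (fun n y hy => ?_) (fun n y hy => key (j+1) n y hy) hx ?_ hx
      · refine HasDerivAt.mul_const (HasDerivAt.const_mul _ ?_) _
        rw [iteratedDeriv_succ]
        exact ((nJ_contDiff α β c n (j+1)).differentiable_iteratedDeriv j (by exact_mod_cast Nat.lt_succ_self j) y).hasDerivAt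
      · exact Summable.of_norm_bounded (summable_exp_jl hα hβ ht j (Cm j * P)) fun n => key j n x hx
  exact main k θ hθ'

lemma nJ_zero_iter (α β : ℝ) (c : ℕ → ℝ) {k : ℕ} (hk : 1 ≤ k) (θ : ℝ) :
    iteratedDeriv k (nJacobi α β c 0) θ = 0 := by
  have : nJacobi α β c 0 = fun _ => nJacobi α β c 0 0 := by
    funext x
    simp [nJacobi, jacobiPoly]
  rw [this, iteratedDeriv_const]
  simp; omega

end Part5

section Part6

lemma nJ_sum_eLp {α β : ℝ} (hα : -1 < α) (hβ : -1 < β) {c : ℕ → ℝ} (hc : JacobiNormalized α β c)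
    (b : ℕ → ℝ) (K : ℕ) :
    eLpNorm (fun φ => ∑ n ∈ Finset.range K, b n * nJacobi α β c n φ) 2 (jacobiMeasure α β) =
      ENNReal.ofReal (Real.sqrt (∑ n ∈ Finset.range K, (b n)^2)) := by
  have hcont : Continuous (fun φ => ∑ n ∈ Finset.range K, b n * nJacobi α β c n φ) :=
    continuous_finsetSum _ fun n _ => continuous_const.mul (nJ_cont α β c n)
  rw [(jm_memLp_cont hα hβ hcont 2).eLpNorm_eq_integral_rpow_norm (by norm_num) (by norm_num)]
  simp only [ENNReal.toReal_ofNat, Real.norm_eq_abs, Real.rpow_two, sq_abs]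
  congr 1
  rw [Real.sqrt_eq_rpow, one_div]
  congr 1
  set s := fun φ => ∑ n ∈ Finset.range K, b n * nJacobi α β c n φ with hs
  have e : ∀ φ, (∑ n ∈ Finset.range K, b n * nJacobi α β c n φ)^2 = ∑ n ∈ Finset.range K, b n * (s φ * nJacobi α β c n φ) := by
    intro φ
    have : (∑ n ∈ Finset.range K, b n * nJacobi α β c n φ) = s φ := rfl
    rw [sq, this]
    conv_lhs => rw [hs]
    rw [Finset.mul_sum]
    exact Finset.sum_congr rfl fun n _ => by ring
  simp only [e]
  rw [integral_finsetSum]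
  · refine Finset.sum_congr rfl fun n hn => ?_
    rw [integral_const_mul, jq_inner hα hβ hc K n b s (fun _ => rfl), if_pos (Finset.mem_range.1 hn)]
    ring
  · intro n _
    exact (jm_integrable_cont hα hβ (hcont.mul (nJ_cont α β c n))).const_mul _

lemma nJ_tsum_eLp {α β : ℝ} (hα : -1 < α) (hβ : -1 < β) {c : ℕ → ℝ} (hc : JacobiNormalized α β c)
    (b : ℕ → ℝ) (hb : Summable fun n => (b n)^2)
    (hp : ∀ φ ∈ Ioo 0 π, Summable fun n => b n * nJacobi α β c n φ) :
    eLpNorm (fun φ => ∑' n, b n * nJacobi α β c n φ) 2 (jacobiMeasure α β) ≤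
      ENNReal.ofReal (Real.sqrt (∑' n, (b n)^2)) := by
  refine (Lp.eLpNorm_lim_le_liminf_eLpNorm (f := fun K φ => ∑ n ∈ Finset.range K, b n * nJacobi α β c n φ)
    (fun K => Continuous.aestronglyMeasurable (continuous_finsetSum _ fun n _ => continuous_const.mul (nJ_cont α β c n))) _ ?_).trans ?_
  · filter_upwards [jm_ae α β] with φ hφ
    exact (hp φ hφ).hasSum.tendsto_sum_nat
  · refine liminf_le_of_frequently_le' (Eventually.frequently (Eventually.of_forall fun K => ?_))
    rw [nJ_sum_eLp hα hβ hc]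
    exact ENNReal.ofReal_le_ofReal (Real.sqrt_le_sqrt (hb.sum_le_tsum _ fun _ _ => sq_nonneg _))

lemma exp_sub_one_ge {x : ℝ} (hx : 0 < x) : x/2 * Real.exp (x/2) ≤ Real.exp x - 1 := by
  have h1 := Real.add_one_le_exp (x/2)
  have e : Real.exp x = Real.exp (x/2) * Real.exp (x/2) := by rw [← Real.exp_add]; ring_nf
  rw [e]
  nlinarith [mul_le_mul_of_nonneg_right h1 (Real.exp_pos (x/2)).le]

lemma geom_exp {x : ℝ} (hx : 0 < x) : HasSum (fun n : ℕ => Real.exp (-x * ((n:ℝ)+1))) (1/(Real.exp x - 1)) := by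
  have h0 : Real.exp (-x) < 1 := by simpa using hx
  have h := (hasSum_geometric_of_lt_one (Real.exp_pos (-x)).le h0).mul_left (Real.exp (-x))
  have e1 : (fun n : ℕ => Real.exp (-x * ((n:ℝ)+1))) = fun n : ℕ => Real.exp (-x) * Real.exp (-x)^n := by
    funext n
    rw [← Real.exp_nat_mul, ← Real.exp_add]; ring_nf
  have e2 : 1/(Real.exp x - 1) = Real.exp (-x) * (1 - Real.exp (-x))⁻¹ := by
    rw [Real.exp_neg]
    have : Real.exp x - 1 > 0 := by linarith [Real.add_one_le_exp x]
    have := Real.exp_pos x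
    field_simp
  rw [e1, e2]; exact h

lemma tail_sq {w : ℕ → ℝ} {C x : ℝ} (hx : 0 < x) (hC : 0 ≤ C) (hw : ∀ n, |w n| ≤ C * Real.exp (-x * ((n:ℝ)+1))) (M : ℕ) :
    Summable (fun n => (if n < M then 0 else w n)^2) ∧ 
    Real.sqrt (∑' n, (if n < M then 0 else w n)^2) ≤ C * (x/2)^(-(1/2:ℝ)) * Real.exp (-(x * (M/2 + 1/4))) := by
  have hle : ∀ n, (if n < M then 0 else w n)^2 ≤ C^2 * Real.exp (-x * M) * Real.exp (-x * ((n:ℝ)+1)) := by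
    intro n
    split_ifs with h
    · simp; positivity
    · have h2 : (M:ℝ) ≤ n := by exact_mod_cast not_lt.1 h
      rw [← sq_abs]
      calc _ ≤ (C * Real.exp (-x * ((n:ℝ)+1)))^2 := by gcongr; exact hw n
        _ = C^2 * Real.exp (-x * ((n:ℝ)+1) + -x * ((n:ℝ)+1)) := by rw [mul_pow, sq (Real.exp _), Real.exp_add]
        _ ≤ C^2 * Real.exp (-x * M + -x * ((n:ℝ)+1)) := by gcongr ?_ * Real.exp ?_; nlinarith
        _ = _ := by rw [Real.exp_add]; ring
  have hs := (geom_exp hx).mul_left (C^2 * Real.exp (-x * M))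
  have hsum : Summable (fun n => (if n < M then 0 else w n)^2) := 
    Summable.of_nonneg_of_le (fun n => sq_nonneg _) hle hs.summable
  refine ⟨hsum, ?_⟩
  have h1 : ∑' n, (if n < M then 0 else w n)^2 ≤ C^2 * Real.exp (-x * M) * (1/(Real.exp x - 1)) :=
    (hsum.tsum_le_tsum hle hs.summable).trans_eq hs.tsum_eq
  apply Real.sqrt_le_iff.2 ⟨by positivity, h1.trans ?_⟩
  have h2 := exp_sub_one_ge hx
  have h3 : 0 < x/2 * Real.exp (x/2) := by positivity
  calc _ ≤ C^2 * Real.exp (-x * M) * (1/(x/2 * Real.exp (x/2))) := by gcongr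
    _ = _ := by
      have e1 : ((x/2)^(-(1/2:ℝ)))^2 = 1/(x/2) := by
        rw [← Real.rpow_natCast, ← Real.rpow_mul (by positivity)]
        norm_num
        rw [Real.rpow_neg_one]; simp
      have e2 : Real.exp (-(x * (M/2 + 1/4)))^2 = Real.exp (-x*M) * (Real.exp (x/2))⁻¹ := by
        rw [← Real.exp_neg, ← Real.exp_add, ← Real.exp_nat_mul]; push_cast; ring_nf
      rw [mul_pow, mul_pow, e1, e2, one_div, one_div, mul_inv]; ring

lemma lint_gamma {r : ℝ} (hr : 0 < r) : ∫⁻ t in Ioi (0:ℝ), ENNReal.ofReal (t^(-(1/2:ℝ)) * Real.exp (-(r*t))) =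
    ENNReal.ofReal ((1/r)^(1/2:ℝ) * Real.Gamma (1/2)) := by
  have h := Real.integral_rpow_mul_exp_neg_mul_Ioi (a := 1/2) (by norm_num) hr
  rw [show (1/2:ℝ) - 1 = -(1/2) by norm_num] at h
  rw [← h, ofReal_integral_eq_lintegral_ofReal]
  · by_contra hn
    rw [integral_undef hn] at h
    have : 0 < (1/r)^(1/2:ℝ) * Real.Gamma (1/2) := mul_pos (by positivity) (Real.Gamma_pos_of_pos (by norm_num))
    linarith
  · filter_upwards [ae_restrict_mem measurableSet_Ioi] with t ht
    have : (0:ℝ) < t := ht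
    simp only [Pi.zero_apply]; positivity

/-- Key Hilbert-space lemma. -/
lemma jB {α β : ℝ} (hα : -1 < α) (hβ : -1 < β) {c : ℕ → ℝ} (hc : JacobiNormalized α β c)
    (w : ℕ → ℝ → ℝ) (hwm : ∀ n, Measurable (w n)) {C δ : ℝ} (hC : 0 ≤ C) (hδ : 0 < δ)
    (hw : ∀ n t, 0 < t → |w n t| ≤ C * Real.exp (-(δ*t) * ((n:ℝ)+1)))
    {g : ℝ → ℝ} (hg : MemLp g 2 (jacobiMeasure α β)) :
    Integrable (fun p : ℝ × ℝ => (∑' n, w n p.1 * nJacobi α β c n p.2) * g p.2) 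
      ((volume.restrict (Ioi 0)).prod (jacobiMeasure α β)) ∧
    Tendsto (fun M => ∑ n ∈ Finset.range M, (∫ t in Ioi (0:ℝ), w n t) * ∫ φ, nJacobi α β c n φ * g φ ∂(jacobiMeasure α β))
      atTop (nhds (∫ p : ℝ × ℝ, (∑' n, w n p.1 * nJacobi α β c n p.2) * g p.2 
        ∂((volume.restrict (Ioi 0)).prod (jacobiMeasure α β)))) := by
  have := jm_finite hα hβ
  set ν : Measure ℝ := volume.restrict (Ioi 0) with hν
  set μ := jacobiMeasure α β with hμ
  have hae : ∀ᵐ p ∂(ν.prod μ), 0 < p.1 ∧ p.2 ∈ Ioo 0 π := by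
    have h1 : ∀ᵐ t ∂ν, 0 < t := ae_restrict_mem measurableSet_Ioi
    filter_upwards [Measure.quasiMeasurePreserving_fst.ae h1, Measure.quasiMeasurePreserving_snd.ae (jm_ae α β)] with p h1 h2
    exact ⟨h1, h2⟩
  have hsum : ∀ t, 0 < t → ∀ φ ∈ Ioo 0 π, Summable fun n => w n t * nJacobi α β c n φ := by
    intro t ht φ hφ
    obtain ⟨P, hP0, hP⟩ := nJ_bound0 hα hβ hc hφ
    refine Summable.of_norm_bounded ((geom_exp (mul_pos hδ ht)).summable.mul_left (C * P)) fun n => ?_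
    rw [Real.norm_eq_abs, abs_mul]
    calc _ ≤ (C * Real.exp (-(δ*t) * ((n:ℝ)+1))) * P := mul_le_mul (hw n t ht) (hP n) (abs_nonneg _) (by positivity)
      _ = _ := by ring
  set F : ℕ → ℝ × ℝ → ℝ := fun M p => (∑ n ∈ Finset.range M, w n p.1 * nJacobi α β c n p.2) * g p.2 with hF
  set f : ℝ × ℝ → ℝ := fun p => (∑' n, w n p.1 * nJacobi α β c n p.2) * g p.2 with hf
  have hwint : ∀ n, Integrable (w n) ν := by
    intro n
    have hi : Integrable (fun t => C * Real.exp (-(δ*((n:ℝ)+1)) * t)) ν :=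
      (exp_neg_integrableOn_Ioi 0 (by positivity)).const_mul C
    refine hi.mono' (hwm n).aestronglyMeasurable ?_
    filter_upwards [ae_restrict_mem measurableSet_Ioi] with t ht
    refine (hw n t ht).trans_eq ?_
    ring_nf
  have hei : ∀ n, Integrable (fun φ => nJacobi α β c n φ * g φ) μ := fun n =>
    MemLp.integrable_mul (jm_memLp_cont hα hβ (nJ_cont α β c n) 2) hg
  have hFe : ∀ M p, F M p = ∑ n ∈ Finset.range M, w n p.1 * (nJacobi α β c n p.2 * g p.2) := by
    intro M p; simp only [hF, Finset.sum_mul, mul_assoc]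
  have hFi : ∀ M, Integrable (F M) (ν.prod μ) := by
    intro M
    rw [show F M = fun p => ∑ n ∈ Finset.range M, w n p.1 * (nJacobi α β c n p.2 * g p.2) from funext (hFe M)]
    exact integrable_finsetSum _ fun n _ => (hwint n).mul_prod (hei n)
  have hFint : ∀ M, ∫ p, F M p ∂(ν.prod μ) = 
      ∑ n ∈ Finset.range M, (∫ t in Ioi (0:ℝ), w n t) * ∫ φ, nJacobi α β c n φ * g φ ∂μ := by
    intro M
    simp only [hFe]
    rw [integral_finsetSum _ fun n _ => (hwint n).mul_prod (hei n)]
    exact Finset.sum_congr rfl fun n _ => integral_prod_mul _ (fun φ => nJacobi α β c n φ * g φ)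
  have hfm : AEStronglyMeasurable f (ν.prod μ) := by
    refine aestronglyMeasurable_of_tendsto_ae atTop (fun M => (hFi M).1) ?_
    filter_upwards [hae] with p hp
    exact ((hsum p.1 hp.1 p.2 hp.2).hasSum.tendsto_sum_nat).mul_const _
  -- main estimate
  set G : ENNReal := eLpNorm g 2 μ with hG
  have hGtop : G ≠ ⊤ := hg.2.ne
  have hest : ∀ M : ℕ, ∫⁻ p, ‖F M p - f p‖ₑ ∂(ν.prod μ) ≤ 
      G * ENNReal.ofReal (C * (δ/2)^(-(1/2:ℝ))) * ENNReal.ofReal ((1/(δ * (M/2+1/4)))^(1/2:ℝ) * Real.Gamma (1/2)) := by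
    intro M
    have hme : AEMeasurable (fun p => ‖F M p - f p‖ₑ) (ν.prod μ) := ((hFi M).1.sub hfm).enorm
    rw [lintegral_prod _ hme, ← lint_gamma (by positivity), ← lintegral_const_mul' _ _ (by finiteness)]
    refine lintegral_mono_ae ?_
    filter_upwards [ae_restrict_mem measurableSet_Ioi] with t ht
    have ht : 0 < t := ht
    have hx : 0 < δ * t := mul_pos hδ ht
    set b : ℕ → ℝ := fun n => if n < M then 0 else w n t with hb
    obtain ⟨hb2, hb3⟩ := tail_sq hx hC (w := fun n => w n t) (fun n => hw n t ht) M
    have hbs : ∀ φ ∈ Ioo 0 π, Summable fun n => b n * nJacobi α β c n φ := by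
      intro φ hφ
      refine Summable.of_norm_bounded (hsum t ht φ hφ).norm fun n => ?_
      simp only [hb]
      split_ifs
      · simp; positivity
      · exact le_rfl
    have h1 := nJ_tsum_eLp hα hβ hc b hb2 hbs
    have hbm : AEStronglyMeasurable (fun φ => ∑' n, b n * nJacobi α β c n φ) μ := by
      refine aestronglyMeasurable_of_tendsto_ae atTop (f := fun K φ => ∑ n ∈ Finset.range K, b n * nJacobi α β c n φ)
        (fun K => Continuous.aestronglyMeasurable (continuous_finsetSum _ fun n _ => continuous_const.mul (nJ_cont α β c n))) ?_
      filter_upwards [jm_ae α β] with φ hφ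
      exact (hbs φ hφ).hasSum.tendsto_sum_nat
    calc ∫⁻ φ, ‖F M (t, φ) - f (t, φ)‖ₑ ∂μ = ∫⁻ φ, ‖((fun φ => ∑' n, b n * nJacobi α β c n φ) • g) φ‖ₑ ∂μ := by
          refine lintegral_congr_ae ?_
          filter_upwards [jm_ae α β] with φ hφ
          rw [enorm_sub_rev]
          congr 1
          simp only [hF, hf, Pi.smul_apply', smul_eq_mul, ← sub_mul]
          congr 1
          rw [← (hsum t ht φ hφ).sum_add_tsum_nat_add M, ← (hbs φ hφ).sum_add_tsum_nat_add M]
          rw [add_sub_cancel_left, Finset.sum_eq_zero, zero_add]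
          · simp [hb]
          · intro n hn; simp [hb, Finset.mem_range.1 hn]
      _ ≤ eLpNorm (fun φ => ∑' n, b n * nJacobi α β c n φ) 2 μ * G := by
          rw [← eLpNorm_one_eq_lintegral_enorm]
          exact eLpNorm_smul_le_mul_eLpNorm hg.1 hbm
      _ ≤ ENNReal.ofReal (C * ((δ*t)/2)^(-(1/2:ℝ)) * Real.exp (-((δ*t) * (M/2 + 1/4)))) * G := by
          gcongr
          exact h1.trans (ENNReal.ofReal_le_ofReal hb3)
      _ = _ := by
          rw [mul_comm _ G, mul_assoc G, ← ENNReal.ofReal_mul (by positivity), show δ*t/2 = δ/2*t by ring,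
            Real.mul_rpow (by positivity) ht.le]
          congr 2
          rw [show δ * t * ((M:ℝ)/2+1/4) = δ * ((M:ℝ)/2+1/4) * t by ring]
          ring
  have hlim : Tendsto (fun M => ∫⁻ p, ‖F M p - f p‖ₑ ∂(ν.prod μ)) atTop (nhds 0) := by
    refine tendsto_of_tendsto_of_tendsto_of_le_of_le tendsto_const_nhds ?_ (fun _ => bot_le) hest
    have h0 : Tendsto (fun M : ℕ => (1/(δ * ((M:ℝ)/2+1/4)))^(1/2:ℝ) * Real.Gamma (1/2)) atTop (nhds 0) := by
      have h1 : Tendsto (fun M : ℕ => δ * ((M:ℝ)/2+1/4)) atTop atTop :=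
        Tendsto.const_mul_atTop hδ (tendsto_atTop_add_const_right _ _ (tendsto_natCast_atTop_atTop.atTop_div_const (by norm_num)))
      have h2 := (tendsto_inv_atTop_zero.comp h1).rpow_const (p := 1/2) (Or.inr (by norm_num))
      have h3 := h2.mul_const (Real.Gamma (1/2))
      rw [Real.zero_rpow (by norm_num), zero_mul] at h3
      simpa using h3
    have h4 := ENNReal.Tendsto.const_mul (a := G * ENNReal.ofReal (C * (δ/2)^(-(1/2:ℝ)))) (ENNReal.tendsto_ofReal h0) (Or.inr (by finiteness))
    simpa using h4
  refine ⟨⟨hfm, ?_⟩, ?_⟩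
  · have h0 := hest 0
    have : ∀ p, ‖F 0 p - f p‖ₑ = ‖f p‖ₑ := by intro p; simp [hF]
    simp only [this] at h0
    exact h0.trans_lt (by finiteness)
  · rw [show (fun M => ∑ n ∈ Finset.range M, (∫ t in Ioi (0:ℝ), w n t) * ∫ φ, nJacobi α β c n φ * g φ ∂μ) = fun M => ∫ p, F M p ∂(ν.prod μ) from funext fun M => (hFint M).symm]
    exact tendsto_integral_of_L1 f hfm (Eventually.of_forall hFi) hlim

end Part6

section Part7

open Polynomial in
lemma jm_complete {α β : ℝ} (hα : -1 < α) (hβ : -1 < β) {c : ℕ → ℝ} (hc : JacobiNormalized α β c)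
    {V : ℝ → ℝ} (hV : Integrable V (jacobiMeasure α β))
    (h0 : ∀ n, ∫ φ, V φ * nJacobi α β c n φ ∂(jacobiMeasure α β) = 0) :
    ∀ᵐ φ ∂(jacobiMeasure α β), V φ = 0 := by
  have hbd : ∀ g : ℝ → ℝ, Continuous g → Integrable (fun φ => V φ * g φ) (jacobiMeasure α β) := by
    intro g hg
    obtain ⟨C, hC⟩ := isCompact_Icc.exists_bound_of_continuousOn (hg.continuousOn (s := Icc 0 π))
    refine hV.mul_bdd (c := C) hg.aestronglyMeasurable ?_
    filter_upwards [jm_ae α β] with φ hφ using hC φ (Ioo_subset_Icc_self hφ)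
  have hpoly : ∀ p : ℝ[X], ∫ φ, V φ * p.eval (Real.cos φ) ∂(jacobiMeasure α β) = 0 := by
    intro p
    obtain ⟨d, hd⟩ := jq_span hα hβ hc (p.natDegree + 1) p (by
      refine (degree_le_natDegree).trans_lt ?_
      exact_mod_cast Nat.lt_succ_self _)
    have e : ∀ φ, V φ * p.eval (Real.cos φ) = ∑ k ∈ Finset.range (p.natDegree+1), d k * (V φ * nJacobi α β c k φ) := by
      intro φ
      have : p.eval (Real.cos φ) = ∑ k ∈ Finset.range (p.natDegree+1), d k * nJacobi α β c k φ := by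
        conv_lhs => rw [hd]
        simp [Polynomial.eval_finsetSum, nJ_eq]
      rw [this, Finset.mul_sum]
      exact Finset.sum_congr rfl fun k _ => by ring
    simp only [e]
    rw [integral_finsetSum _ fun k _ => (hbd _ (nJ_cont α β c k)).const_mul (d k)]
    refine Finset.sum_eq_zero fun k _ => ?_
    rw [integral_const_mul, h0, mul_zero]
  refine ae_eq_zero_of_integral_contDiff_smul_eq_zero hV.locallyIntegrable ?_
  intro g hg _
  have hgc := hg.continuous
  simp only [smul_eq_mul, mul_comm (g _)]
  set I := ∫ φ, V φ * g φ ∂(jacobiMeasure α β)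
  set K := ∫ φ, |V φ| ∂(jacobiMeasure α β)
  have hK : 0 ≤ K := integral_nonneg fun _ => abs_nonneg _
  by_contra hI
  have hI' : 0 < |I| := abs_pos.2 hI
  obtain ⟨p, hp⟩ := exists_polynomial_near_of_continuousOn (-1) 1 (fun x => g (Real.arccos x))
    (hgc.comp Real.continuous_arccos).continuousOn (|I| / (K + 1)) (by positivity)
  have hpc : Continuous fun φ => p.eval (Real.cos φ) := p.continuous.comp Real.continuous_cos
  have h2 : I = ∫ φ, V φ * (g φ - p.eval (Real.cos φ)) ∂(jacobiMeasure α β) := by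
    simp only [mul_sub]
    rw [integral_sub (hbd g hgc) (hbd _ hpc), hpoly, sub_zero]
  have h3 : |I| ≤ K * (|I| / (K+1)) := by
    conv_lhs => rw [h2]
    refine (abs_integral_le_integral_abs).trans ?_
    rw [← integral_mul_const]
    refine integral_mono_ae (hbd _ (hgc.sub hpc)).abs (hV.abs.mul_const _) ?_
    filter_upwards [jm_ae α β] with φ hφ
    simp only [abs_mul]
    refine mul_le_mul_of_nonneg_left ?_ (abs_nonneg _)
    have := hp (Real.cos φ) ⟨Real.neg_one_le_cos φ, Real.cos_le_one φ⟩
    rw [Real.arccos_cos hφ.1.le hφ.2.le, abs_sub_comm] at this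
    exact this.le
  have : K * (|I| / (K+1)) < |I| := by
    rw [mul_div_assoc', div_lt_iff₀ (by positivity)]; nlinarith
  linarith

lemma pow_exp_bd (j : ℕ) {s : ℝ} (hs : 0 ≤ s) : s^j * Real.exp (-(s/4)) ≤ 8^j * (j.factorial:ℝ) * Real.exp (-(s/8)) := by
  have h := Real.pow_div_factorial_le_exp (s/8) (by positivity) j
  have hf : (0:ℝ) < j.factorial := by exact_mod_cast j.factorial_pos
  rw [div_le_iff₀ hf, div_pow, div_le_iff₀ (by positivity)] at h
  have e : Real.exp (s/8) * Real.exp (-(s/4)) = Real.exp (-(s/8)) := by rw [← Real.exp_add]; ring_nf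
  calc _ ≤ Real.exp (s/8) * (j.factorial:ℝ) * 8^j * Real.exp (-(s/4)) := by gcongr
    _ = 8^j * (j.factorial:ℝ) * (Real.exp (s/8) * Real.exp (-(s/4))) := by ring
    _ = _ := by rw [e]

/-- basic weight bound -/
lemma exp_jl_pow {α β : ℝ} (hα : -1 < α) (hβ : -1 < β) (j : ℕ) {n : ℕ} (hn : 1 ≤ n) {t : ℝ} (ht : 0 < t) :
    (t * ((n:ℝ)+1))^j * Real.exp (-(jl α β n * t)) ≤ 8^j * (j.factorial:ℝ) * Real.exp (-(1/8*t) * ((n:ℝ)+1)) := by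
  have hs : 0 ≤ t * ((n:ℝ)+1) := by positivity
  refine le_trans (mul_le_mul_of_nonneg_left (Real.exp_le_exp.2 ?_) (by positivity)) ((pow_exp_bd j hs).trans_eq ?_)
  · nlinarith [jl_lower hα hβ hn]
  · ring_nf

/-- Gamma integral -/
lemma gamma_int {N : ℕ} (hN : 1 ≤ N) {r : ℝ} (hr : 0 < r) :
    ∫ t in Ioi (0:ℝ), t^(N-1) * Real.exp (-(r*t)) = Real.Gamma N / r^N := by
  have h := Real.integral_rpow_mul_exp_neg_mul_Ioi (a := N) (by exact_mod_cast hN) hr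
  rw [Real.rpow_natCast] at h
  have e : ((1/r)^N * Real.Gamma N) = Real.Gamma N / r^N := by rw [one_div, inv_pow]; ring
  rw [← e, ← h]
  refine setIntegral_congr_fun measurableSet_Ioi fun t ht => ?_
  have e2 : t^(N-1) = t^((N:ℝ)-1) := by
    rw [← Real.rpow_natCast]; push_cast [hN]; rfl
  simp only [e2]

/-- Multiplier of the main part. -/
def mN (α β : ℝ) (N n : ℕ) (t : ℝ) : ℝ :=
  if n = 0 then 0 else (jl α β n)^N * (t^(N-1) * Real.exp (-(jl α β n * t)))

lemma mN_meas (α β : ℝ) (N n : ℕ) : Measurable (mN α β N n) := by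
  unfold mN; split_ifs <;> fun_prop

lemma mN_int {α β : ℝ} (hα : -1 < α) (hβ : -1 < β) {N : ℕ} (hN : 1 ≤ N) (n : ℕ) :
    ∫ t in Ioi (0:ℝ), mN α β N n t = if n = 0 then 0 else Real.Gamma N := by
  unfold mN
  split_ifs with h
  · simp
  · have h1 : 1 ≤ n := Nat.one_le_iff_ne_zero.2 h
    have h2 : 0 < jl α β n := lt_of_lt_of_le (by positivity) (jl_lower hα hβ h1)
    rw [integral_const_mul, gamma_int hN h2]; field_simp

lemma mN_bound {α β : ℝ} (hα : -1 < α) (hβ : -1 < β) {N : ℕ} (hN : 1 ≤ N) : ∃ D, 0 ≤ D ∧ ∀ n t, 0 < t →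
    |mN α β N n t| ≤ D * (n+1) * Real.exp (-(1/8*t) * ((n:ℝ)+1)) := by
  set K := 1 + |jacobiTau α β| with hK
  refine ⟨K^N * (8^(N-1) * ((N-1).factorial:ℝ)), by positivity, fun n t ht => ?_⟩
  unfold mN
  split_ifs with h
  · simp; positivity
  · have h1 : 1 ≤ n := Nat.one_le_iff_ne_zero.2 h
    have h3 := jl_upper α β n
    have h4 := jl_nonneg α β n
    have h2 := exp_jl_pow hα hβ (N-1) h1 ht
    rw [abs_of_nonneg (by positivity)]
    calc _ ≤ (K * ((n:ℝ)+1))^N * (t^(N-1) * Real.exp (-(jl α β n * t))) := by gcongr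
      _ = K^N * ((n:ℝ)+1) * ((t * ((n:ℝ)+1))^(N-1) * Real.exp (-(jl α β n * t))) := by
        obtain ⟨M, rfl⟩ := Nat.exists_eq_add_of_le' hN
        simp only [Nat.add_sub_cancel, mul_pow]; ring
      _ ≤ K^N * ((n:ℝ)+1) * (8^(N-1) * ((N-1).factorial:ℝ) * Real.exp (-(1/8*t) * ((n:ℝ)+1))) := by gcongr
      _ = _ := by ring

lemma mN_diff {α β : ℝ} (hα : -1 < α) (hβ : -1 < β) {N : ℕ} (hN : 1 ≤ N) : ∃ D, 0 ≤ D ∧ ∀ n t, 0 < t →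
    |mN α β N (n+1) t - mN α β N n t| ≤ D * Real.exp (-(1/8*t) * ((n:ℝ)+1)) := by
  obtain ⟨D0, hD0, hD⟩ := mN_bound hα hβ hN
  set K := 1 + |jacobiTau α β| with hK
  have hK0 : 0 ≤ K := by positivity
  refine ⟨2 * D0 + (N * (K+1)^(N-1) * (8^(N-1) * ((N-1).factorial:ℝ)) + K^N * (8^N * (N.factorial:ℝ))), by positivity, fun n t ht => ?_⟩
  rcases Nat.eq_zero_or_pos n with rfl | hn
  · have h := hD 1 t ht
    have : mN α β N 0 t = 0 := by simp [mN]
    rw [this, sub_zero]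
    refine h.trans ?_
    have h5 : Real.exp (-(1/8*t) * (((1:ℕ):ℝ)+1)) ≤ Real.exp (-(1/8*t) * (((0:ℕ):ℝ)+1)) := 
      Real.exp_le_exp.2 (by push_cast; nlinarith)
    calc _ ≤ D0 * (((1:ℕ):ℝ)+1) * Real.exp (-(1/8*t) * (((0:ℕ):ℝ)+1)) := by gcongr
      _ = (2 * D0) * Real.exp (-(1/8*t) * (((0:ℕ):ℝ)+1)) := by push_cast; ring
      _ ≤ _ := by gcongr; exact le_add_of_nonneg_right (by positivity)
  · have e1 : jl α β (n+1) = jl α β n + 1 := by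
      rw [jl_eq hα hβ hn, jl_eq hα hβ (by omega)]; push_cast; ring
    have h3 := jl_upper α β n
    have h4 := jl_nonneg α β n
    have hx : (1:ℝ) ≤ (n:ℝ)+1 := by linarith [(Nat.cast_nonneg n : (0:ℝ) ≤ n)]
    simp only [mN, if_neg (Nat.succ_ne_zero n), if_neg (Nat.pos_iff_ne_zero.1 hn), e1]
    set l := jl α β n with hl
    have hl1 : l + 1 ≤ (K+1) * ((n:ℝ)+1) := by linarith
    have e2 : (l+1)^N * (t^(N-1) * Real.exp (-((l+1)*t))) - l^N * (t^(N-1) * Real.exp (-(l*t)))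
      = ((l+1)^N - l^N) * t^(N-1) * (Real.exp (-(l*t)) * Real.exp (-t)) - l^N * t^(N-1) * Real.exp (-(l*t)) * (1 - Real.exp (-t)) := by
      rw [show -((l+1)*t) = -(l*t) + -t by ring, Real.exp_add]; ring
    rw [e2]
    have h5 : |(l+1)^N - l^N| ≤ N * ((K+1) * ((n:ℝ)+1))^(N-1) := by
      refine (abs_pow_sub_pow_le _ _ _).trans ?_
      rw [add_sub_cancel_left, abs_one, one_mul, abs_of_nonneg h4, abs_of_nonneg (by linarith), max_eq_left (by linarith)]
      gcongr
    have h6 : Real.exp (-t) ≤ 1 := by simpa using ht.le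
    have h7 : 1 - Real.exp (-t) ≤ t := by linarith [Real.add_one_le_exp (-t)]
    have h8 : |1 - Real.exp (-t)| ≤ t := by rw [abs_of_nonneg (by linarith)]; exact h7
    have b1 := exp_jl_pow hα hβ (N-1) hn ht
    have b2 := exp_jl_pow hα hβ N hn ht
    rw [← hl] at b1 b2
    refine (abs_sub _ _).trans ?_
    simp only [abs_mul, abs_of_nonneg (Real.exp_pos _).le, abs_pow, abs_of_nonneg h4, abs_of_pos ht]
    calc _ ≤ (N * ((K+1) * ((n:ℝ)+1))^(N-1)) * t^(N-1) * (Real.exp (-(l*t)) * 1) + (K * ((n:ℝ)+1))^N * t^(N-1) * Real.exp (-(l*t)) * t := by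
            gcongr
      _ = N * (K+1)^(N-1) * ((t * ((n:ℝ)+1))^(N-1) * Real.exp (-(l*t))) + K^N * ((t * ((n:ℝ)+1))^N * Real.exp (-(l*t))) := by
        obtain ⟨M, rfl⟩ := Nat.exists_eq_add_of_le' hN
        simp only [Nat.add_sub_cancel, mul_pow]; ring
      _ ≤ N * (K+1)^(N-1) * (8^(N-1) * ((N-1).factorial:ℝ) * Real.exp (-(1/8*t) * ((n:ℝ)+1))) + K^N * (8^N * (N.factorial:ℝ) * Real.exp (-(1/8*t) * ((n:ℝ)+1))) := by gcongr
      _ = (N * (K+1)^(N-1) * (8^(N-1) * ((N-1).factorial:ℝ)) + K^N * (8^N * (N.factorial:ℝ))) * Real.exp (-(1/8*t) * ((n:ℝ)+1)) := by ring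
      _ ≤ _ := by
        refine mul_le_mul_of_nonneg_right ?_ (Real.exp_pos _).le
        exact le_add_of_nonneg_left (by positivity)

lemma comm_sum {a b E F m w : ℕ → ℝ} {x x0 : ℝ}
    (hE0 : x0 * E 0 = a 0 * E 1 + b 0 * E 0) (hE : ∀ n, x0 * E (n+1) = a (n+1) * E (n+2) + b (n+1) * E (n+1) + a n * E n)
    (hF0 : x * F 0 = a 0 * F 1 + b 0 * F 0) (hF : ∀ n, x * F (n+1) = a (n+1) * F (n+2) + b (n+1) * F (n+1) + a n * F n)
    (hw0 : w 0 = a 0 * (m 1 - m 0) * E 1)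
    (hw : ∀ n, w (n+1) = a n * (m n - m (n+1)) * E n + a (n+1) * (m (n+2) - m (n+1)) * E (n+2)) (M : ℕ) :
    ∑ n ∈ Finset.range (M+1), w n * F n = (x - x0) * ∑ n ∈ Finset.range (M+1), m n * E n * F n
      + a M * (m (M+1) * E (M+1) * F M - m M * E M * F (M+1)) := by
  induction M with
  | zero => 
    simp only [zero_add, Finset.sum_range_one, hw0]
    linear_combination (m 0 * F 0) * hE0 - m 0 * E 0 * hF0
  | succ M ih => 
    rw [Finset.sum_range_succ, ih, Finset.sum_range_succ _ (M+1), hw M]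
    linear_combination (m (M+1) * F (M+1)) * hE M - m (M+1) * E (M+1) * hF M

lemma cd_sum {a b E d G : ℕ → ℝ} {x0 : ℝ}
    (hE0 : x0 * E 0 = a 0 * E 1 + b 0 * E 0) (hE : ∀ n, x0 * E (n+1) = a (n+1) * E (n+2) + b (n+1) * E (n+1) + a n * E n)
    (hG0 : G 0 = a 0 * d 1 + b 0 * d 0) (hG : ∀ n, G (n+1) = a (n+1) * d (n+2) + b (n+1) * d (n+1) + a n * d n) (M : ℕ) :
    ∑ n ∈ Finset.range (M+1), (G n - x0 * d n) * E n = a M * (d (M+1) * E M - d M * E (M+1)) := by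
  induction M with
  | zero => 
    simp only [zero_add, Finset.sum_range_one, hG0]
    linear_combination (- d 0) * hE0
  | succ M ih => 
    rw [Finset.sum_range_succ, ih, hG M]
    linear_combination (-d (M+1)) * hE M

end Part7

section Part8

lemma mN_summable {α β : ℝ} (hα : -1 < α) (hβ : -1 < β) {c : ℕ → ℝ} (hc : JacobiNormalized α β c)
    {N : ℕ} (hN : 1 ≤ N) {θ φ : ℝ} (hθ : θ ∈ Ioo 0 π) (hφ : φ ∈ Ioo 0 π) {t : ℝ} (ht : 0 < t) :
    Summable (fun n => mN α β N n t) ∧ Summable (fun n => mN α β N n t * nJacobi α β c n θ * nJacobi α β c n φ) := by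
  obtain ⟨D, hD0, hD⟩ := mN_bound hα hβ hN
  obtain ⟨P, hP0, hP⟩ := nJ_bound0 hα hβ hc hθ
  obtain ⟨Q, hQ0, hQ⟩ := nJ_bound0 hα hβ hc hφ
  have hs := (summable_pow_exp (s := 1/8*t) (by positivity) 1)
  refine ⟨Summable.of_norm_bounded (hs.mul_left D) fun n => ?_, 
    Summable.of_norm_bounded (hs.mul_left (D*P*Q)) fun n => ?_⟩
  · refine (hD n t ht).trans_eq (by ring)
  · rw [norm_mul, norm_mul]
    calc _ ≤ (D * (n+1) * Real.exp (-(1/8*t) * ((n:ℝ)+1))) * P * Q := by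
          gcongr
          · exact hD n t ht
          · exact hP n
          · exact hQ n
      _ = _ := by ring

/-- The principal part integrates to minus the constant mode. -/
lemma jT {α β : ℝ} (hα : -1 < α) (hβ : -1 < β) {c : ℕ → ℝ} (hc : JacobiNormalized α β c)
    {N : ℕ} (hN : 1 ≤ N) {θ : ℝ} (hθ : θ ∈ Ioo 0 π) :
    ∀ᵐ φ ∂(jacobiMeasure α β), 
      IntegrableOn (fun t => ∑' n, mN α β N n t * nJacobi α β c n θ * nJacobi α β c n φ) (Ioi 0) ∧
      ∫ t in Ioi (0:ℝ), ∑' n, mN α β N n t * nJacobi α β c n θ * nJacobi α β c n φ =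
        - (Real.Gamma N * nJacobi α β c 0 θ * nJacobi α β c 0 φ) := by
  have := jm_finite hα hβ
  obtain ⟨a, b, ha, hr0, hr⟩ := jq_rec hα hβ hc
  obtain ⟨D, hD0, hD⟩ := mN_diff hα hβ hN
  obtain ⟨P, hP0, hP⟩ := nJ_bound0 hα hβ hc hθ
  obtain ⟨D1, hD10, hD1⟩ := mN_bound hα hβ hN
  set E : ℕ → ℝ := fun n => nJacobi α β c n θ with hE
  set m : ℕ → ℝ → ℝ := mN α β N with hm
  set w : ℕ → ℝ → ℝ := fun k t => Nat.casesOn k (a 0 * (m 1 t - m 0 t) * E 1)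
    (fun k => a k * (m k t - m (k+1) t) * E k + a (k+1) * (m (k+2) t - m (k+1) t) * E (k+2)) with hw
  have hw0 : ∀ t, w 0 t = a 0 * (m 1 t - m 0 t) * E 1 := fun t => rfl
  have hws : ∀ k t, w (k+1) t = a k * (m k t - m (k+1) t) * E k + a (k+1) * (m (k+2) t - m (k+1) t) * E (k+2) := fun k t => rfl
  have hmm : ∀ n, Measurable (m n) := mN_meas α β N
  have hwm : ∀ n, Measurable (w n) := by
    intro n
    cases n with
    | zero => 
      simp only [funext hw0]
      have := hmm 0; have := hmm 1
      fun_prop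
    | succ k =>
      simp only [funext (hws k)]
      have := hmm k; have := hmm (k+1); have := hmm (k+2)
      fun_prop
  have hterm : ∀ k j t, 0 < t → |a k * (m (k+1) t - m k t) * E j| ≤ D * P * Real.exp (-(1/8*t) * ((k:ℝ)+1)) := by
    intro k j t ht
    rw [abs_mul, abs_mul]
    calc _ ≤ 1 * (D * Real.exp (-(1/8*t) * ((k:ℝ)+1))) * P := by
          gcongr
          · exact ha k
          · exact hD k t ht
          · exact hP j
      _ = _ := by ring
  have hwb : ∀ n t, 0 < t → |w n t| ≤ (2*(D*P)) * Real.exp (-(1/16*t) * ((n:ℝ)+1)) := by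
    intro n t ht
    cases n with
    | zero => 
      rw [hw0]
      refine (hterm 0 1 t ht).trans ?_
      have : Real.exp (-(1/8*t) * (((0:ℕ):ℝ)+1)) ≤ Real.exp (-(1/16*t) * (((0:ℕ):ℝ)+1)) := 
        Real.exp_le_exp.2 (by push_cast; linarith)
      have h0 : 0 ≤ D * P := by positivity
      have l3 := mul_le_mul_of_nonneg_left this h0
      have l4 : 0 ≤ D * P * Real.exp (-(1/16*t) * (((0:ℕ):ℝ)+1)) := by positivity
      linarith
    | succ k =>
      rw [hws]
      refine (abs_add_le _ _).trans ?_
      have h1 := hterm k k t ht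
      have h2 := hterm (k+1) (k+2) t ht
      have e1 : |a k * (m k t - m (k+1) t) * E k| = |a k * (m (k+1) t - m k t) * E k| := by
        rw [← abs_neg]; ring_nf
      rw [e1]
      have hk : (0:ℝ) ≤ k := by positivity
      have l1 : Real.exp (-(1/8*t) * ((k:ℝ)+1)) ≤ Real.exp (-(1/16*t) * (((k+1:ℕ):ℝ)+1)) := 
        Real.exp_le_exp.2 (by push_cast; nlinarith)
      have l2 : Real.exp (-(1/8*t) * (((k+1:ℕ):ℝ)+1)) ≤ Real.exp (-(1/16*t) * (((k+1:ℕ):ℝ)+1)) := 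
        Real.exp_le_exp.2 (by push_cast; nlinarith)
      have h0 : 0 ≤ D * P := by positivity
      have l3 := mul_le_mul_of_nonneg_left l1 h0
      have l4 := mul_le_mul_of_nonneg_left l2 h0
      linarith
  -- commutator identity
  have hcomm : ∀ t, 0 < t → ∀ φ ∈ Ioo 0 π, 
      ∑' n, w n t * nJacobi α β c n φ = (Real.cos φ - Real.cos θ) * ∑' n, m n t * nJacobi α β c n θ * nJacobi α β c n φ := by
    intro t ht φ hφ
    obtain ⟨hs1, hs2⟩ := mN_summable hα hβ hc hN hθ hφ ht
    obtain ⟨Q, hQ0, hQ⟩ := nJ_bound0 hα hβ hc hφ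
    have hsw : Summable fun n => w n t * nJacobi α β c n φ := by
      refine Summable.of_norm_bounded ((geom_exp (x := 1/16*t) (by positivity)).summable.mul_left (2*(D*P) * Q)) fun n => ?_
      rw [norm_mul]
      calc _ ≤ ((2*(D*P)) * Real.exp (-(1/16*t) * ((n:ℝ)+1))) * Q := by
            gcongr
            · exact hwb n t ht
            · exact hQ n
        _ = _ := by ring
    have l1 := (hsw.hasSum.tendsto_sum_nat).comp (tendsto_add_atTop_nat 1)
    have l2 := ((hs2.hasSum.tendsto_sum_nat).comp (tendsto_add_atTop_nat 1)).const_mul (Real.cos φ - Real.cos θ)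
    have hbd : ∀ M, ‖a M * (m (M+1) t * E (M+1) * nJacobi α β c M φ - m M t * E M * nJacobi α β c (M+1) φ)‖ ≤
        P * Q * (|m (M+1) t| + |m M t|) := by
      intro M
      rw [norm_mul, Real.norm_eq_abs, Real.norm_eq_abs]
      have k1 : |m (M+1) t * E (M+1) * nJacobi α β c M φ| ≤ |m (M+1) t| * P * Q := by
        rw [abs_mul, abs_mul]; gcongr
        · exact hP _
        · exact hQ _
      have k2 : |m M t * E M * nJacobi α β c (M+1) φ| ≤ |m M t| * P * Q := by
        rw [abs_mul, abs_mul]; gcongr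
        · exact hP _
        · exact hQ _
      calc _ ≤ 1 * (|m (M+1) t| * P * Q + |m M t| * P * Q) := by
            gcongr
            · exact ha M
            · exact (abs_sub _ _).trans (add_le_add k1 k2)
        _ = _ := by ring
    have l3 : Tendsto (fun M => a M * (m (M+1) t * E (M+1) * nJacobi α β c M φ - m M t * E M * nJacobi α β c (M+1) φ)) atTop (nhds 0) := by
      refine squeeze_zero_norm hbd ?_
      have z := hs1.tendsto_atTop_zero.abs
      have z1 := z.comp (tendsto_add_atTop_nat 1)
      have := (z1.add z).const_mul (P*Q)
      simpa using this
    have l4 := l2.add l3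
    rw [add_zero] at l4
    refine tendsto_nhds_unique l1 (l4.congr fun M => ?_)
    have := comm_sum (a := a) (b := b) (E := E) (F := fun n => nJacobi α β c n φ) (m := fun n => m n t) (w := fun n => w n t)
      (hr0 θ) (fun n => hr n θ) (hr0 φ) (fun n => hr n φ) (hw0 t) (fun n => hws n t) M
    exact this.symm
  -- integrals of w
  have hmi : ∀ n, Integrable (m n) (volume.restrict (Ioi 0)) := by
    intro n
    have hi : Integrable (fun t => D1 * (n+1) * Real.exp (-(1/8*((n:ℝ)+1)) * t)) (volume.restrict (Ioi 0)) :=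
      (exp_neg_integrableOn_Ioi 0 (by positivity)).const_mul _
    refine hi.mono' (hmm n).aestronglyMeasurable ?_
    filter_upwards [ae_restrict_mem measurableSet_Ioi] with t ht
    refine (hD1 n t ht).trans_eq ?_
    ring_nf
  have hmint := mN_int hα hβ (N := N) hN
  have hwi0 : ∫ t in Ioi (0:ℝ), w 0 t = a 0 * Real.Gamma N * E 1 := by
    simp only [hw0]
    rw [integral_mul_const, integral_const_mul, integral_sub (hmi 1) (hmi 0), hmint, hmint]; simp
  have hwis : ∀ k, ∫ t in Ioi (0:ℝ), w (k+1) t = if k = 0 then - (a 0 * Real.Gamma N * E 0) else 0 := by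
    intro k
    simp only [hws]
    have i1 : Integrable (fun t => a k * (m k t - m (k+1) t) * E k) (volume.restrict (Ioi 0)) :=
      (((hmi k).sub (hmi (k+1))).const_mul _).mul_const _
    have i2 : Integrable (fun t => a (k+1) * (m (k+2) t - m (k+1) t) * E (k+2)) (volume.restrict (Ioi 0)) :=
      (((hmi (k+2)).sub (hmi (k+1))).const_mul _).mul_const _
    rw [integral_add i1 i2,
      integral_mul_const, integral_const_mul, integral_sub (hmi k) (hmi (k+1)), 
      integral_mul_const, integral_const_mul, integral_sub (hmi (k+2)) (hmi (k+1)), hmint, hmint, hmint]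
    rcases k with _ | k
    · simp
    · simp
  -- Hilbert lemma
  have hδ : (0:ℝ) < 1/16 := by norm_num
  have hC : 0 ≤ 2*(D*P) := by positivity
  have hB := fun (g : ℝ → ℝ) hg => jB hα hβ hc w hwm hC hδ hwb (g := g) hg
  have h1 := (hB (fun _ => 1) (jm_memLp_cont hα hβ continuous_const 2)).1
  simp only [mul_one] at h1
  set U : ℝ → ℝ := fun φ => ∫ t in Ioi (0:ℝ), ∑' n, w n t * nJacobi α β c n φ with hU
  have hUi : Integrable U (jacobiMeasure α β) := h1.integral_prod_right
  have hUj : ∀ j, ∫ φ, U φ * nJacobi α β c j φ ∂(jacobiMeasure α β) = ∫ t in Ioi (0:ℝ), w j t := by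
    intro j
    obtain ⟨i1, i2⟩ := hB _ (jm_memLp_cont hα hβ (nJ_cont α β c j) 2)
    rw [integral_prod_symm _ i1] at i2
    simp only [integral_mul_const] at i2
    refine tendsto_nhds_unique i2 ?_
    refine tendsto_const_nhds.congr' ?_
    filter_upwards [eventually_gt_atTop j] with M hM
    simp only [jq_orthonormal hα hβ hc]
    simp [hM]
  set γ := Real.Gamma N
  set V : ℝ → ℝ := fun φ => U φ - γ * a 0 * (E 1 * nJacobi α β c 0 φ - E 0 * nJacobi α β c 1 φ) with hV
  have hcont : Continuous fun φ => γ * a 0 * (E 1 * nJacobi α β c 0 φ - E 0 * nJacobi α β c 1 φ) :=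
    continuous_const.mul ((continuous_const.mul (nJ_cont α β c 0)).sub (continuous_const.mul (nJ_cont α β c 1)))
  have hVi : Integrable V (jacobiMeasure α β) := hUi.sub (jm_integrable_cont hα hβ hcont)
  have hV0 : ∀ᵐ φ ∂(jacobiMeasure α β), V φ = 0 := by
    refine jm_complete hα hβ hc hVi fun j => ?_
    have e : ∀ φ, V φ * nJacobi α β c j φ = U φ * nJacobi α β c j φ - γ * a 0 * (E 1 * (nJacobi α β c 0 φ * nJacobi α β c j φ) - E 0 * (nJacobi α β c 1 φ * nJacobi α β c j φ)) := by
      intro φ; simp only [hV]; ring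
    simp only [e]
    have q1 : Integrable (fun φ => U φ * nJacobi α β c j φ) (jacobiMeasure α β) := by
      obtain ⟨C, hC⟩ := isCompact_Icc.exists_bound_of_continuousOn ((nJ_cont α β c j).continuousOn (s := Icc 0 π))
      refine hUi.mul_bdd (c := C) (nJ_cont α β c j).aestronglyMeasurable ?_
      filter_upwards [jm_ae α β] with φ hφ using hC φ (Ioo_subset_Icc_self hφ)
    have q2 : ∀ i, Integrable (fun φ => nJacobi α β c i φ * nJacobi α β c j φ) (jacobiMeasure α β) := fun i =>
      jm_integrable_cont hα hβ ((nJ_cont α β c i).mul (nJ_cont α β c j))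
    have q3 : Integrable (fun φ => γ * a 0 * (E 1 * (nJacobi α β c 0 φ * nJacobi α β c j φ) - E 0 * (nJacobi α β c 1 φ * nJacobi α β c j φ))) (jacobiMeasure α β) :=
      (((q2 0).const_mul _).sub ((q2 1).const_mul _)).const_mul _
    rw [integral_sub q1 q3, hUj, integral_const_mul,
      integral_sub ((q2 0).const_mul _) ((q2 1).const_mul _), integral_const_mul, integral_const_mul,
      jq_orthonormal hα hβ hc, jq_orthonormal hα hβ hc]
    rcases j with _ | _ | j
    · rw [hwi0]; simp; ring
    · rw [hwis]; simp; ring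
    · rw [hwis]; simp
  -- conclude
  have hne : ∀ᵐ φ ∂(jacobiMeasure α β), φ ≠ θ := 
    (jm_ac α β).ae_le (Measure.ae_ne volume θ)
  filter_upwards [hV0, hne, jm_ae α β, h1.prod_left_ae] with φ v1 v2 v3 v4
  have hx : Real.cos φ - Real.cos θ ≠ 0 := by
    intro h
    exact v2 (Real.injOn_cos (Ioo_subset_Icc_self v3) (Ioo_subset_Icc_self hθ) (by linarith))
  have hcong : ∀ t ∈ Ioi (0:ℝ), ∑' n, w n t * nJacobi α β c n φ = (Real.cos φ - Real.cos θ) * ∑' n, m n t * nJacobi α β c n θ * nJacobi α β c n φ :=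
    fun t ht => hcomm t ht φ v3
  constructor
  · have v5 : IntegrableOn (fun t => (Real.cos φ - Real.cos θ) * ∑' n, m n t * nJacobi α β c n θ * nJacobi α β c n φ) (Ioi 0) :=
      IntegrableOn.congr_fun v4 hcong measurableSet_Ioi
    have v6 := v5.const_mul (Real.cos φ - Real.cos θ)⁻¹
    refine v6.congr (Eventually.of_forall fun t => ?_)
    simp only
    rw [inv_mul_cancel_left₀ hx]
  · have v7 : U φ = (Real.cos φ - Real.cos θ) * ∫ t in Ioi (0:ℝ), ∑' n, m n t * nJacobi α β c n θ * nJacobi α β c n φ := by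
      simp only [hU]
      rw [setIntegral_congr_fun measurableSet_Ioi hcong, integral_const_mul]
    simp only [hV, v7, sub_eq_zero] at v1
    apply mul_left_cancel₀ hx
    rw [v1]
    have r1 := hr0 θ
    have r2 := hr0 φ
    simp only [hE]
    linear_combination (γ * nJacobi α β c 0 θ) * r2 - γ * nJacobi α β c 0 φ * r1

end Part8

section Part9

/-- Bessel: coefficients of an `L²` function tend to zero. -/
lemma bessel_zero {α β : ℝ} (hα : -1 < α) (hβ : -1 < β) {c : ℕ → ℝ} (hc : JacobiNormalized α β c)
    {h : ℝ → ℝ} (hh : MemLp h 2 (jacobiMeasure α β)) :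
    Tendsto (fun n => ∫ φ, h φ * nJacobi α β c n φ ∂(jacobiMeasure α β)) atTop (nhds 0) := by
  set d : ℕ → ℝ := fun n => ∫ φ, h φ * nJacobi α β c n φ ∂(jacobiMeasure α β) with hd
  have hq : Integrable (fun φ => h φ ^ 2) (jacobiMeasure α β) := hh.integrable_sq
  have hm : ∀ k : ℕ, Integrable (fun φ => h φ * nJacobi α β c k φ) (jacobiMeasure α β) := fun k =>
    hh.integrable_mul (jm_memLp_cont hα hβ (nJ_cont α β c k) 2)
  have hB : ∀ M, ∑ n ∈ Finset.range M, d n ^ 2 ≤ ∫ φ, h φ ^ 2 ∂(jacobiMeasure α β) := by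
    intro M
    set S : ℝ → ℝ := fun φ => ∑ k ∈ Finset.range M, d k * nJacobi α β c k φ with hS
    have hSc : Continuous S := continuous_finsetSum _ fun k _ => continuous_const.mul (nJ_cont α β c k)
    have hSi : ∀ m, ∫ φ, S φ * nJacobi α β c m φ ∂(jacobiMeasure α β) = if m < M then d m else 0 :=
      fun m => jq_inner hα hβ hc M m d S fun θ => rfl
    have e1 : ∫ φ, h φ * S φ ∂(jacobiMeasure α β) = ∑ n ∈ Finset.range M, d n ^ 2 := by
      have : ∀ φ, h φ * S φ = ∑ k ∈ Finset.range M, d k * (h φ * nJacobi α β c k φ) := by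
        intro φ; simp only [hS]; rw [Finset.mul_sum]; exact Finset.sum_congr rfl fun k _ => by ring
      simp only [this]
      rw [integral_finsetSum _ fun k _ => (hm k).const_mul _]
      refine Finset.sum_congr rfl fun k _ => ?_
      rw [integral_const_mul]; simp only [hd]; ring
    have e2 : ∫ φ, S φ * S φ ∂(jacobiMeasure α β) = ∑ n ∈ Finset.range M, d n ^ 2 := by
      have : ∀ φ, S φ * S φ = ∑ k ∈ Finset.range M, d k * (S φ * nJacobi α β c k φ) := by
        intro φ; conv_lhs => rw [hS]
        simp only
        rw [Finset.mul_sum]; exact Finset.sum_congr rfl fun k _ => by ring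
      simp only [this]
      have hi : ∀ k, Integrable (fun φ => S φ * nJacobi α β c k φ) (jacobiMeasure α β) := fun k =>
        jm_integrable_cont hα hβ (hSc.mul (nJ_cont α β c k))
      rw [integral_finsetSum _ fun k _ => (hi k).const_mul _]
      refine Finset.sum_congr rfl fun k hk => ?_
      rw [integral_const_mul, hSi, if_pos (Finset.mem_range.1 hk)]; ring
    have i1 : Integrable (fun φ => h φ * S φ) (jacobiMeasure α β) :=
      hh.integrable_mul (jm_memLp_cont hα hβ hSc 2)
    have i2 : Integrable (fun φ => S φ * S φ) (jacobiMeasure α β) := jm_integrable_cont hα hβ (hSc.mul hSc)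
    have h0 : 0 ≤ ∫ φ, (h φ - S φ)^2 ∂(jacobiMeasure α β) := integral_nonneg fun φ => sq_nonneg _
    have e3 : ∀ φ, (h φ - S φ)^2 = (h φ ^2 - 2 * (h φ * S φ)) + S φ * S φ := fun φ => by ring
    simp only [e3] at h0
    have i3 : Integrable (fun φ => 2 * (h φ * S φ)) (jacobiMeasure α β) := i1.const_mul 2
    have i4 : Integrable (fun φ => h φ ^2 - 2 * (h φ * S φ)) (jacobiMeasure α β) := hq.sub i3
    rw [integral_add i4 i2, integral_sub hq i3, integral_const_mul, e1, e2] at h0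
    linarith
  have hs : Summable fun n => d n ^ 2 := summable_of_sum_range_le (fun n => sq_nonneg _) hB
  have := hs.tendsto_atTop_zero
  rw [tendsto_zero_iff_abs_tendsto_zero]
  have h2 := this.sqrt
  simp only [Real.sqrt_sq_eq_abs, Real.sqrt_zero] at h2
  exact h2

lemma jw_hasDerivAt (α β : ℝ) {θ : ℝ} (h : θ ∈ Ioo 0 π) : HasDerivAt (jw α β) (jw α β θ * jb α β θ) θ := by
  have s := sinh_pos h
  have k := cosh_pos h
  have h1 : HasDerivAt (fun θ : ℝ => Real.sin (θ/2)) (Real.cos (θ/2) * (1/2)) θ :=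
    ((hasDerivAt_id θ).div_const 2).sin
  have h2 : HasDerivAt (fun θ : ℝ => Real.cos (θ/2)) (-Real.sin (θ/2) * (1/2)) θ :=
    ((hasDerivAt_id θ).div_const 2).cos
  have d := (h1.rpow_const (p := 2*α+1) (Or.inl s.ne')).mul (h2.rpow_const (p := 2*β+1) (Or.inl k.ne'))
  refine d.congr_deriv ?_
  rw [Real.rpow_sub_one s.ne', Real.rpow_sub_one k.ne']
  have e1 : Real.sin θ = 2 * Real.sin (θ/2) * Real.cos (θ/2) := by rw [← Real.sin_two_mul]; ring_nf
  have e2 : Real.cos θ = Real.cos (θ/2)^2 - Real.sin (θ/2)^2 := by rw [← Real.cos_two_mul']; ring_nf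
  have e3 : Real.sin (θ/2)^2 + Real.cos (θ/2)^2 = 1 := Real.sin_sq_add_cos_sq _
  unfold jw jb
  rw [e1, e2]
  set A := Real.sin (θ/2)
  set B := Real.cos (θ/2)
  set X := A ^ (2*α+1)
  set Y := B ^ (2*β+1)
  field_simp
  linear_combination (X*Y*(α-β)) * e3

/-- decay of coefficients -/
lemma coef_decay {α β : ℝ} (hα : -1 < α) (hβ : -1 < β) {c : ℕ → ℝ} (hc : JacobiNormalized α β c)
    {f : ℝ → ℝ} (hf : IsCcSmooth f) :
    ∃ K, 0 ≤ K ∧ ∀ n, |jnu α β n * ∫ φ, f φ * nJacobi α β c n φ ∂(jacobiMeasure α β)| ≤ K := by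
  obtain ⟨f1, f2, f3⟩ := hf
  have hout : ∀ x, x ∉ Ioo 0 π → f =ᶠ[nhds x] 0 := fun x hx => 
    notMem_tsupport_iff_eventuallyEq.1 fun h => hx (f3 h)
  have hd1 : ∀ x, HasDerivAt f (deriv f x) x := fun x =>
    (f1.differentiable (by simp)).differentiableAt.hasDerivAt
  have f1' : ContDiff ℝ (⊤ : ℕ∞) (deriv f) := by
    have := (contDiff_infty_iff_deriv (𝕜 := ℝ) (f := f)).1 f1
    exact this.2
  have f1'' : ContDiff ℝ (⊤ : ℕ∞) (deriv (deriv f)) := by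
    have := (contDiff_infty_iff_deriv (𝕜 := ℝ) (f := deriv f)).1 f1'
    exact this.2
  have hd2 : ∀ x, HasDerivAt (deriv f) (deriv (deriv f) x) x := fun x =>
    (f1'.differentiable (by simp)).differentiableAt.hasDerivAt
  have hout1 : ∀ x, x ∉ Ioo 0 π → deriv f =ᶠ[nhds x] 0 := fun x hx => by
    have := (hout x hx).deriv
    refine this.trans (Eventually.of_forall fun y => ?_)
    simp
  set g : ℝ → ℝ := fun x => deriv (deriv f) x + jb α β x * deriv f x with hg
  have hgc : Continuous g := by
    refine f1''.continuous.add (continuous_iff_continuousAt.2 fun x => ?_)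
    by_cases hx : x ∈ Ioo 0 π
    · exact (jb_contDiffAt α β 0 hx).continuousAt.mul f1'.continuous.continuousAt
    · refine (continuousAt_const (y := (0:ℝ))).congr ?_
      filter_upwards [hout1 x hx] with y hy
      rw [hy]; simp
  refine ⟨(∫ φ, g φ ^2 ∂(jacobiMeasure α β) + 1)/2, ?_, fun n => ?_⟩
  · have : 0 ≤ ∫ φ, g φ ^2 ∂(jacobiMeasure α β) := integral_nonneg fun φ => sq_nonneg _
    positivity
  have i1 : Integrable (fun φ => g φ * nJacobi α β c n φ) (jacobiMeasure α β) :=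
    jm_integrable_cont hα hβ (hgc.mul (nJ_cont α β c n))
  have i2 : Integrable (fun φ => jnu α β n * (f φ * nJacobi α β c n φ)) (jacobiMeasure α β) :=
    (jm_integrable_cont hα hβ (f1.continuous.mul (nJ_cont α β c n))).const_mul _
  have key : ∫ φ, (-(jnu α β n * (f φ * nJacobi α β c n φ)) - g φ * nJacobi α β c n φ) ∂(jacobiMeasure α β) = 0 := by
    have hz : ∀ x, x ∉ Ioo 0 π → (fun x => jw α β x * (f x * deriv (nJacobi α β c n) x - deriv f x * nJacobi α β c n x)) =ᶠ[nhds x] 0 := by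
      intro x hx
      filter_upwards [hout x hx, hout1 x hx] with y h1 h2
      simp [h1, h2]
    have hD : ∀ θ ∈ Ioo 0 π, HasDerivAt (fun x => jw α β x * (f x * deriv (nJacobi α β c n) x - deriv f x * nJacobi α β c n x))
        (jw α β θ * (-(jnu α β n * (f θ * nJacobi α β c n θ)) - g θ * nJacobi α β c n θ)) θ := by
      intro θ hθ
      have he : HasDerivAt (nJacobi α β c n) (deriv (nJacobi α β c n) θ) θ :=
        (nJ_hasDerivAt α β c n θ).differentiableAt.hasDerivAt
      have := (jw_hasDerivAt α β hθ).mul (((hd1 θ).mul (nJ_ode hα hβ c n hθ)).sub ((hd2 θ).mul he))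
      refine this.congr_deriv ?_
      simp only [hg, Pi.mul_apply, Pi.sub_apply]
      ring
    refine jm_ftc (F := fun x => jw α β x * (f x * deriv (nJacobi α β c n) x - deriv f x * nJacobi α β c n x)) ?_ ?_ ?_ hD ?_
    · intro x _
      refine ContinuousAt.continuousWithinAt ?_
      by_cases hx : x ∈ Ioo 0 π
      · exact (hD x hx).continuousAt
      · exact (continuousAt_const (y := (0:ℝ))).congr (hz x hx).symm
    · exact (hz 0 (by simp)).self_of_nhds
    · exact (hz π (by simp)).self_of_nhds
    · exact i2.neg.sub i1
  have i3 : Integrable (fun φ => -(jnu α β n * (f φ * nJacobi α β c n φ))) (jacobiMeasure α β) := i2.neg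
  rw [integral_sub i3 i1, integral_neg, integral_const_mul] at key
  have e : jnu α β n * ∫ φ, f φ * nJacobi α β c n φ ∂(jacobiMeasure α β) = - ∫ φ, g φ * nJacobi α β c n φ ∂(jacobiMeasure α β) := by
    linarith
  rw [e, abs_neg]
  have j1 : Integrable (fun φ => g φ ^2) (jacobiMeasure α β) := jm_integrable_cont hα hβ (hgc.pow 2)
  have j2 : Integrable (fun φ => nJacobi α β c n φ ^2) (jacobiMeasure α β) := jm_integrable_cont hα hβ ((nJ_cont α β c n).pow 2)
  have j3 : Integrable (fun φ => (g φ ^2 + nJacobi α β c n φ ^2)/2) (jacobiMeasure α β) := (j1.add j2).div_const 2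
  have e2 : ∫ φ, (g φ ^2 + nJacobi α β c n φ ^2)/2 ∂(jacobiMeasure α β) = (∫ φ, g φ ^2 ∂(jacobiMeasure α β) + 1)/2 := by
    rw [integral_div, integral_add j1 j2, hc.2 n]
  rw [← e2]
  refine (abs_integral_le_integral_abs).trans (integral_mono i1.abs j3 fun φ => ?_)
  simp only
  rw [abs_mul]
  nlinarith [sq_nonneg (|g φ| - |nJacobi α β c n φ|), sq_abs (g φ), sq_abs (nJacobi α β c n φ)]

lemma coef_summable {α β : ℝ} (hα : -1 < α) (hβ : -1 < β) {c : ℕ → ℝ} (hc : JacobiNormalized α β c)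
    {f : ℝ → ℝ} (hf : IsCcSmooth f) :
    Summable fun n => |∫ φ, f φ * nJacobi α β c n φ ∂(jacobiMeasure α β)| := by
  obtain ⟨K, hK0, hK⟩ := coef_decay hα hβ hc hf
  have hab : 0 < α + β + 2 := by linarith
  rw [← summable_nat_add_iff 2]
  have hs : Summable fun n : ℕ => K * (1 / ((n+1:ℕ):ℝ)^2) := 
    ((summable_nat_add_iff 1).2 (Real.summable_one_div_nat_pow.2 (by norm_num : 1 < 2))).mul_left K
  refine Summable.of_nonneg_of_le (fun n => abs_nonneg _) (fun n => ?_) hs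
  have := hK (n+2)
  rw [abs_mul] at this
  set I := |∫ φ, f φ * nJacobi α β c (n+2) φ ∂(jacobiMeasure α β)| with hI
  have hI0 : 0 ≤ I := abs_nonneg _
  have hn : (0:ℝ) ≤ n := by positivity
  have l : ((n:ℝ)+1)^2 ≤ |jnu α β (n+2)| := by
    refine le_trans ?_ (le_abs_self _)
    unfold jnu; push_cast; nlinarith
  rw [mul_one_div, le_div_iff₀ (by positivity)]
  push_cast
  calc I * ((n:ℝ)+1)^2 ≤ I * |jnu α β (n+2)| := by gcongr
    _ = |jnu α β (n+2)| * I := by ring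
    _ ≤ K := this

/-- pointwise expansion -/
lemma expansion {α β : ℝ} (hα : -1 < α) (hβ : -1 < β) {c : ℕ → ℝ} (hc : JacobiNormalized α β c)
    {f : ℝ → ℝ} (hf : IsCcSmooth f) {θ : ℝ} (hθ : θ ∈ Ioo 0 π) :
    HasSum (fun n => (∫ φ, f φ * nJacobi α β c n φ ∂(jacobiMeasure α β)) * nJacobi α β c n θ) (f θ) := by
  have hfin := jm_finite hα hβ
  obtain ⟨P, hP0, hP⟩ := nJ_bound0 hα hβ hc hθ
  have hsum : Summable (fun n => (∫ φ, f φ * nJacobi α β c n φ ∂(jacobiMeasure α β)) * nJacobi α β c n θ) := by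
    refine Summable.of_norm_bounded ((coef_summable hα hβ hc hf).mul_right P) fun n => ?_
    rw [norm_mul, Real.norm_eq_abs, Real.norm_eq_abs]
    gcongr
    exact hP n
  obtain ⟨a, b, ha, hr0, hr⟩ := jq_rec hα hβ hc
  have hfc := hf.1.continuous
  have hfd : DifferentiableAt ℝ f θ := (hf.1.differentiable (by simp)).differentiableAt
  set h : ℝ → ℝ := fun φ => dslope f θ φ / dslope Real.cos θ φ with hh
  have hcne : ∀ φ ∈ Icc 0 π, dslope Real.cos θ φ ≠ 0 := by
    intro φ hφ
    by_cases e : φ = θ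
    · rw [e, dslope_same, Real.deriv_cos, neg_ne_zero]
      exact (Real.sin_pos_of_mem_Ioo hθ).ne'
    · rw [dslope_of_ne _ e, slope_def_field]
      refine div_ne_zero (fun h => e ?_) (sub_ne_zero.2 e)
      exact Real.injOn_cos hφ (Ioo_subset_Icc_self hθ) (by linarith)
  have hcont : ContinuousOn h (Icc 0 π) := by
    have hn : Icc 0 π ∈ nhds θ := Icc_mem_nhds hθ.1 hθ.2
    refine ContinuousOn.div ((continuousOn_dslope hn).2 ⟨hfc.continuousOn, hfd⟩)
      ((continuousOn_dslope hn).2 ⟨Real.continuous_cos.continuousOn, Real.differentiableAt_cos⟩) hcne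
  have hmul : ∀ φ ∈ Icc 0 π, (Real.cos φ - Real.cos θ) * h φ = f φ - f θ := by
    intro φ hφ
    have e1 := sub_smul_dslope f θ φ
    have e2 := sub_smul_dslope Real.cos θ φ
    simp only [smul_eq_mul] at e1 e2
    rw [← e1, ← e2, hh]
    have := hcne φ hφ
    field_simp
  have hmeas : AEStronglyMeasurable h (jacobiMeasure α β) := by
    have h1 : AEStronglyMeasurable h (volume.restrict (Ioo 0 π)) :=
      (hcont.mono Ioo_subset_Icc_self).aestronglyMeasurable measurableSet_Ioo
    exact h1.mono_ac (withDensity_absolutelyContinuous _ _)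
  obtain ⟨C, hC⟩ := isCompact_Icc.exists_bound_of_continuousOn hcont
  have hL : MemLp h 2 (jacobiMeasure α β) := jm_memLp hα hβ hmeas (fun φ hφ => hC φ (Ioo_subset_Icc_self hφ)) 2
  have hitg : ∀ n, Integrable (fun φ => h φ * nJacobi α β c n φ) (jacobiMeasure α β) := fun n =>
    hL.integrable_mul (jm_memLp_cont hα hβ (nJ_cont α β c n) 2)
  have hitgc : ∀ n, Integrable (fun φ => h φ * (Real.cos φ * nJacobi α β c n φ)) (jacobiMeasure α β) := fun n =>
    hL.integrable_mul (jm_memLp_cont hα hβ (Real.continuous_cos.mul (nJ_cont α β c n)) 2)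
  set d : ℕ → ℝ := fun n => ∫ φ, h φ * nJacobi α β c n φ ∂(jacobiMeasure α β) with hd
  set G : ℕ → ℝ := fun n => ∫ φ, h φ * (Real.cos φ * nJacobi α β c n φ) ∂(jacobiMeasure α β) with hG
  have hG0 : G 0 = a 0 * d 1 + b 0 * d 0 := by
    simp only [hG, hd]
    rw [← integral_const_mul, ← integral_const_mul, ← integral_add ((hitg 1).const_mul _) ((hitg 0).const_mul _)]
    congr 1; ext φ; rw [hr0]; ring
  have hGs : ∀ n, G (n+1) = a (n+1) * d (n+2) + b (n+1) * d (n+1) + a n * d n := by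
    intro n
    simp only [hG, hd]
    have i1 : Integrable (fun φ => a (n+1) * (h φ * nJacobi α β c (n+2) φ) + b (n+1) * (h φ * nJacobi α β c (n+1) φ)) (jacobiMeasure α β) :=
      ((hitg (n+2)).const_mul _).add ((hitg (n+1)).const_mul _)
    rw [← integral_const_mul, ← integral_const_mul, ← integral_const_mul, ← integral_add ((hitg (n+2)).const_mul _) ((hitg (n+1)).const_mul _),
      ← integral_add i1 ((hitg n).const_mul _)]
    congr 1; ext φ; rw [hr]; ring
  have hcd := cd_sum (a := a) (b := b) (E := fun n => nJacobi α β c n θ) (d := d) (G := G) (hr0 θ) (fun n => hr n θ) hG0 hGs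
  -- constant function
  have he0 : ∀ φ, nJacobi α β c 0 φ = nJacobi α β c 0 θ := by
    intro φ; simp [nJacobi, jacobiPoly]
  have hone : ∀ n, (∫ φ, nJacobi α β c n φ ∂(jacobiMeasure α β)) * nJacobi α β c n θ = if n = 0 then 1 else 0 := by
    intro n
    have o := jq_orthonormal hα hβ hc 0 n
    simp only [he0] at o
    rw [integral_const_mul] at o
    by_cases hn : n = 0
    · subst hn
      simp only [if_true] at o ⊢
      linarith
    · rw [if_neg (Ne.symm hn)] at o
      rw [if_neg hn]
      have o2 := jq_orthonormal hα hβ hc 0 0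
      have : nJacobi α β c 0 θ ≠ 0 := by
        intro z
        simp [he0, z] at o2
      rcases mul_eq_zero.1 o with h | h
      · exact absurd h this
      · rw [h, zero_mul]
  have hfn : ∀ n, (∫ φ, f φ * nJacobi α β c n φ ∂(jacobiMeasure α β)) = f θ * (∫ φ, nJacobi α β c n φ ∂(jacobiMeasure α β)) +
      (G n - Real.cos θ * d n) := by
    intro n
    simp only [hG, hd]
    have i0 := jm_integrable_cont hα hβ (nJ_cont α β c n)
    have i1 : Integrable (fun φ => h φ * (Real.cos φ * nJacobi α β c n φ) - Real.cos θ * (h φ * nJacobi α β c n φ)) (jacobiMeasure α β) :=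
      (hitgc n).sub ((hitg n).const_mul _)
    rw [← integral_const_mul, ← integral_const_mul, ← integral_sub (hitgc n) ((hitg n).const_mul _), ← integral_add (i0.const_mul _) i1]
    refine integral_congr_ae ?_
    filter_upwards [jm_ae α β] with φ hφ
    have := hmul φ (Ioo_subset_Icc_self hφ)
    linear_combination (-nJacobi α β c n φ) * this
  have hpart : ∀ M, ∑ n ∈ Finset.range (M+1), (∫ φ, f φ * nJacobi α β c n φ ∂(jacobiMeasure α β)) * nJacobi α β c n θ =
      f θ + a M * (d (M+1) * nJacobi α β c M θ - d M * nJacobi α β c (M+1) θ) := by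
    intro M
    rw [← hcd M]
    have : ∀ n, (∫ φ, f φ * nJacobi α β c n φ ∂(jacobiMeasure α β)) * nJacobi α β c n θ = f θ * (if n = 0 then 1 else 0) +
        (G n - Real.cos θ * d n) * nJacobi α β c n θ := by
      intro n; rw [hfn, ← hone n]; ring
    simp only [this]
    rw [Finset.sum_add_distrib, ← Finset.mul_sum]
    simp
  have hd0 : Tendsto d atTop (nhds 0) := bessel_zero hα hβ hc hL
  have l3 : Tendsto (fun M => a M * (d (M+1) * nJacobi α β c M θ - d M * nJacobi α β c (M+1) θ)) atTop (nhds 0) := by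
    have hbd : ∀ M, ‖a M * (d (M+1) * nJacobi α β c M θ - d M * nJacobi α β c (M+1) θ)‖ ≤ P * (|d (M+1)| + |d M|) := by
      intro M
      rw [norm_mul, Real.norm_eq_abs, Real.norm_eq_abs]
      have k1 : |d (M+1) * nJacobi α β c M θ| ≤ |d (M+1)| * P := by
        rw [abs_mul]; gcongr; exact hP _
      have k2 : |d M * nJacobi α β c (M+1) θ| ≤ |d M| * P := by
        rw [abs_mul]; gcongr; exact hP _
      calc _ ≤ 1 * (|d (M+1)| * P + |d M| * P) := by
            gcongr
            · exact ha M
            · exact (abs_sub _ _).trans (add_le_add k1 k2)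
        _ = _ := by ring
    refine squeeze_zero_norm hbd ?_
    have z := hd0.abs
    have z1 := z.comp (tendsto_add_atTop_nat 1)
    have := (z1.add z).const_mul P
    simpa using this
  have l4 := (hsum.hasSum.tendsto_sum_nat).comp (tendsto_add_atTop_nat 1)
  have l5 : Tendsto (fun M => f θ + a M * (d (M+1) * nJacobi α β c M θ - d M * nJacobi α β c (M+1) θ)) atTop (nhds (f θ)) := by
    simpa using l3.const_add (f θ)
  have := tendsto_nhds_unique l4 (l5.congr fun M => (hpart M).symm)
  rw [← this]
  exact hsum.hasSum

end Part9

section Part10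

lemma jacobi_main (α β : ℝ) (hα : -1 < α) (hβ : -1 < β)
    (c : ℕ → ℝ) (hc : JacobiNormalized α β c)
    (N m : ℕ) (hN : 2 ≤ N) (hNm : N = 2 * m)
    (f : ℝ → ℝ) (hf : IsCcSmooth f)
    (θ : ℝ) (hθ : θ ∈ Set.Ioo 0 π) :
    Integrable (fun φ => rieszKer α β c N θ φ * f φ) (jacobiMeasure α β) ∧
    rieszTransform α β c N f θ =
      (-1 : ℝ)^m * f θ +
        ∫ φ, rieszKer α β c N θ φ * f φ ∂(jacobiMeasure α β) := by
  have hfin := jm_finite hα hβ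
  have hN1 : 1 ≤ N := by omega
  have hγ : 0 < Real.Gamma N := Real.Gamma_pos_of_pos (by positivity)
  set γ := Real.Gamma N with hγd
  obtain ⟨R, hR0, hR⟩ := rem_bound hα hβ hc hθ m
  rw [← hNm] at hR
  obtain ⟨P, hP0, hP⟩ := nJ_bound0 hα hβ hc hθ
  set E : ℕ → ℝ := fun n => nJacobi α β c n θ with hE
  set r : ℕ → ℝ := fun n => iteratedDeriv N (nJacobi α β c n) θ - (-1)^m * (jl α β n)^N * E n with hr
  have hrb : ∀ n, |r n| ≤ R * ((n:ℝ)+1)^(N-1) := by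
    intro n
    have h1 := hR n
    have h2 : ((n:ℝ)+1)^N = ((n:ℝ)+1)^(N-1) * ((n:ℝ)+1) := by
      rw [← pow_succ]; congr 1; omega
    rw [h2, ← mul_assoc] at h1
    exact le_of_mul_le_mul_right h1 (by positivity)
  set w : ℕ → ℝ → ℝ := fun n t => if n = 0 then 0 else r n * (t^(N-1) * Real.exp (-(jl α β n * t))) with hw
  have hwm : ∀ n, Measurable (w n) := by
    intro n
    simp only [hw]
    split_ifs <;> fun_prop
  have hwb : ∀ n t, 0 < t → |w n t| ≤ (R * (8^(N-1) * ((N-1).factorial:ℝ))) * Real.exp (-(1/8*t) * ((n:ℝ)+1)) := by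
    intro n t ht
    by_cases hn : n = 0
    · simp only [hw, if_pos hn, abs_zero]; positivity
    · simp only [hw, if_neg hn]
      have h1 := exp_jl_pow hα hβ (N-1) (Nat.one_le_iff_ne_zero.2 hn) ht
      rw [abs_mul, abs_of_nonneg (a := t^(N-1) * _) (by positivity)]
      calc _ ≤ (R * ((n:ℝ)+1)^(N-1)) * (t^(N-1) * Real.exp (-(jl α β n * t))) := by
            gcongr; exact hrb n
        _ = R * ((t * ((n:ℝ)+1))^(N-1) * Real.exp (-(jl α β n * t))) := by rw [mul_pow]; ring
        _ ≤ R * (8^(N-1) * ((N-1).factorial:ℝ) * Real.exp (-(1/8*t) * ((n:ℝ)+1))) := by gcongr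
        _ = _ := by ring
  have hlp : ∀ n : ℕ, n ≠ 0 → 0 < jl α β n := by
    intro n hn
    have := jl_lower hα hβ (Nat.one_le_iff_ne_zero.2 hn)
    have h2 : (0:ℝ) < ((n:ℝ)+1)/4 := by positivity
    linarith
  have hwi : ∀ n, ∫ t in Ioi (0:ℝ), w n t = if n = 0 then 0 else γ * (r n / (jl α β n)^N) := by
    intro n
    by_cases hn : n = 0
    · simp [hw, hn]
    · simp only [hw, if_neg hn]
      rw [integral_const_mul, gamma_int hN1 (hlp n hn)]; ring
  have hC : 0 ≤ R * (8^(N-1) * ((N-1).factorial:ℝ)) := by positivity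
  have hδ : (0:ℝ) < 1/8 := by norm_num
  have hfc := hf.1.continuous
  have h1 := (jB hα hβ hc w hwm hC hδ hwb (jm_memLp_cont hα hβ (continuous_const (y := (1:ℝ))) 2)).1
  simp only [mul_one] at h1
  obtain ⟨g1, g2⟩ := jB hα hβ hc w hwm hC hδ hwb (jm_memLp_cont hα hβ hfc 2)
  set U : ℝ → ℝ := fun φ => ∫ t in Ioi (0:ℝ), ∑' n, w n t * nJacobi α β c n φ with hU
  -- kernel formula
  have hker : ∀ᵐ φ ∂(jacobiMeasure α β), rieszKer α β c N θ φ = 1/γ * U φ - (-1)^m * (E 0 * nJacobi α β c 0 φ) := by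
    filter_upwards [jT hα hβ hc hN1 hθ, jm_ae α β, h1.prod_left_ae] with φ p1 p2 p3
    obtain ⟨Q, hQ0, hQ⟩ := nJ_bound0 hα hβ hc p2
    have hpt : ∀ t ∈ Ioi (0:ℝ), iteratedDeriv N (fun θ' => poissonKer α β c t θ' φ) θ * t^(N-1) =
        (∑' n, w n t * nJacobi α β c n φ) + (-1)^m * ∑' n, mN α β N n t * nJacobi α β c n θ * nJacobi α β c n φ := by
      intro t ht
      rw [poisson_deriv hα hβ hc hθ p2 ht, ← tsum_mul_right, ← tsum_mul_left]
      have s1 : Summable fun n => w n t * nJacobi α β c n φ := by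
        have ht' : 0 < 1/8*t := by have : 0 < t := ht; positivity
        refine Summable.of_norm_bounded ((geom_exp ht').summable.mul_left (R * (8^(N-1) * ((N-1).factorial:ℝ)) * Q)) fun n => ?_
        rw [norm_mul]
        calc _ ≤ ((R * (8^(N-1) * ((N-1).factorial:ℝ))) * Real.exp (-(1/8*t) * ((n:ℝ)+1))) * Q := by
              gcongr
              · exact hwb n t ht
              · exact hQ n
          _ = _ := by ring
      have s2 := (mN_summable hα hβ hc hN1 hθ p2 ht).2.mul_left ((-1)^m)
      rw [← s1.tsum_add s2]
      refine tsum_congr fun n => ?_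
      by_cases hn : n = 0
      · subst hn
        rw [nJ_zero_iter α β c hN1]
        simp [hw, mN]
      · simp only [hw, mN, if_neg hn, hr, hE]
        rw [show -t * jl α β n = -(jl α β n * t) by ring]
        ring
    unfold rieszKer
    rw [setIntegral_congr_fun measurableSet_Ioi hpt, integral_add p3 (p1.1.const_mul _), integral_const_mul, p1.2]
    simp only [hU, hE]
    field_simp
    ring
  have i1 : Integrable (fun φ => U φ * f φ) (jacobiMeasure α β) := by
    have := g1.integral_prod_right
    simp only [integral_mul_const] at this
    exact this
  have i2 : Integrable (fun φ => f φ * nJacobi α β c 0 φ) (jacobiMeasure α β) :=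
    jm_integrable_cont hα hβ (hfc.mul (nJ_cont α β c 0))
  have i3 : Integrable (fun φ => 1/γ * (U φ * f φ)) (jacobiMeasure α β) := i1.const_mul _
  have i4 : Integrable (fun φ => (-1)^m * E 0 * (f φ * nJacobi α β c 0 φ)) (jacobiMeasure α β) := i2.const_mul _
  have hcongr : (fun φ => rieszKer α β c N θ φ * f φ) =ᵐ[jacobiMeasure α β] 
      fun φ => 1/γ * (U φ * f φ) - (-1)^m * E 0 * (f φ * nJacobi α β c 0 φ) := by
    filter_upwards [hker] with φ h
    rw [h]; ring
  refine ⟨(i3.sub i4).congr hcongr.symm, ?_⟩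
  rw [integral_congr_ae hcongr, integral_sub i3 i4, integral_const_mul, integral_const_mul]
  -- series
  set F : ℕ → ℝ := fun n => ∫ φ, f φ * nJacobi α β c n φ ∂(jacobiMeasure α β) with hF
  have hexp := expansion hα hβ hc hf hθ
  have hFs := coef_summable hα hβ hc hf
  have hq : ∀ n, |r (n+1) / (jl α β (n+1))^N| ≤ R * 4^N := by
    intro n
    have l0 := hlp (n+1) (by omega)
    have l1 := jl_lower hα hβ (n := n+1) (by omega)
    rw [abs_div, abs_of_pos (a := (jl α β (n+1))^N) (by positivity), div_le_iff₀ (by positivity)]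
    refine (hrb (n+1)).trans ?_
    rw [mul_assoc]
    refine mul_le_mul_of_nonneg_left ?_ hR0
    have l2 : (((n+1:ℕ):ℝ)+1)^N ≤ (4 * jl α β (n+1))^N := by
      gcongr; linarith
    rw [mul_pow] at l2
    refine le_trans ?_ l2
    refine pow_le_pow_right₀ ?_ (by omega)
    have : (0:ℝ) ≤ ((n+1:ℕ):ℝ) := by positivity
    linarith
  have s1 : Summable fun n => (if n = 0 then 0 else r n / (jl α β n)^N) * F n := by
    rw [← summable_nat_add_iff 1]
    refine Summable.of_norm_bounded (((summable_nat_add_iff 1).2 hFs).mul_left (R * 4^N)) fun n => ?_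
    rw [norm_mul, if_neg (by omega), Real.norm_eq_abs, Real.norm_eq_abs]
    gcongr
    exact hq n
  have hUf : ∫ φ, U φ * f φ ∂(jacobiMeasure α β) = γ * ∑' n, (if n = 0 then 0 else r n / (jl α β n)^N) * F n := by
    rw [integral_prod_symm _ g1] at g2
    simp only [integral_mul_const] at g2
    refine tendsto_nhds_unique g2 ?_
    refine (s1.hasSum.tendsto_sum_nat.const_mul γ).congr fun M => ?_
    rw [Finset.mul_sum]
    refine Finset.sum_congr rfl fun n _ => ?_
    rw [hwi]
    have : ∫ φ, nJacobi α β c n φ * f φ ∂(jacobiMeasure α β) = F n := by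
      simp only [hF]; congr 1; ext φ; ring
    rw [this]
    split_ifs <;> ring
  rw [hUf, ← mul_assoc, one_div_mul_cancel hγ.ne', one_mul]
  have s2 : HasSum (fun n => F n * E n) (f θ) := hexp
  rw [← s2.tsum_eq, s2.summable.tsum_eq_zero_add, s1.tsum_eq_zero_add]
  simp only [if_true, zero_mul, zero_add, Nat.add_eq_zero_iff, one_ne_zero, and_false, if_false]
  have t1 := ((summable_nat_add_iff 1).2 s1)
  simp only [Nat.add_eq_zero_iff, one_ne_zero, and_false, if_false] at t1
  have t2 := ((summable_nat_add_iff 1).2 s2.summable).mul_left ((-1)^m)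
  have goal : rieszTransform α β c N f θ = ∑' n, ((-1)^m * (F (n+1) * E (n+1)) + r (n+1) / jl α β (n+1)^N * F (n+1)) := by
    unfold rieszTransform
    refine tsum_congr fun n => ?_
    have l0 := hlp (n+1) (by omega)
    have e : |((n:ℝ)+1) + jacobiTau α β| = jl α β (n+1) := by unfold jl; push_cast; rfl
    have e2 : jacobiInner α β f (nJacobi α β c (n+1)) = F (n+1) := rfl
    rw [e, e2, Real.rpow_neg l0.le, Real.rpow_natCast]
    simp only [hr]
    field_simp
    ring
  rw [goal, t2.tsum_add t1, tsum_mul_left]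
  ring

end Part10

/-- For even `N ≥ 2`, `f ∈ C_c^∞(0,π)` and `θ ∈ (0,π)`, the integral
`∫₀^π R_N(θ,φ) f(φ) dμ(φ)` converges absolutely and
`R_N f(θ) = (−1)^{N/2} f(θ) + ∫₀^π R_N(θ,φ) f(φ) dμ(φ)`. -/
theorem riesz_jacobi_even_integral_representation
    (α β : ℝ) (hα : -1 < α) (hβ : -1 < β)
    (c : ℕ → ℝ) (hc : JacobiNormalized α β c)
    (N : ℕ) (hN : 2 ≤ N) (hNeven : Even N)
    (f : ℝ → ℝ) (hf : IsCcSmooth f)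
    (θ : ℝ) (hθ : θ ∈ Set.Ioo 0 π) :
    Integrable (fun φ => rieszKer α β c N θ φ * f φ) (jacobiMeasure α β) ∧
    rieszTransform α β c N f θ =
      (-1 : ℝ)^(N/2) * f θ +
        ∫ φ, rieszKer α β c N θ φ * f φ ∂(jacobiMeasure α β) := by
  obtain ⟨m, hm⟩ := hNeven
  have h2 : N / 2 = m := by omega
  rw [h2]
  exact jacobi_main α β hα hβ c hc N m hN (by omega) f hf θ hθ

end
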